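/- arXiv:1302.0829 — 7 statements merged into one kernel-verified Lean document; each statement's English description precedes it below -/
import Mathlib

section
/- Let K be a closed sublattice of ∏_{i=1}^n L_i as in the product setting. Let 1 ≤ i ≤ n and let p, q be clopen prime filters of L_i with q̃ ⊆ p̃, K ∖ p̃ ≠ ∅ and q̃ ≠ ∅, and let (a,b) be a gate between K ∖ p̃ and q̃. Then π_i(a) < π_i(b); for every c ∈ K with π_i(a) < π_i(c) < π_i(b) we have c ∉ q̃ and c ∈ p̃; in particular K ∖ p̃ = {x ∈ K : π_i(x) ≤ π_i(a)} and q̃ = {x ∈ K : π_i(x) ≥ π_i(b)}. -/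
/-- A *filter* in a lattice: for all `a, b ∈ F`, every `x` with `a ⊓ b ≤ x` belongs to `F`. -/
def IsLatFilter {α : Type*} [Lattice α] (F : Set α) : Prop :=
  ∀ a ∈ F, ∀ b ∈ F, ∀ x : α, a ⊓ b ≤ x → x ∈ F

/-- An *ideal* in a lattice: for all `a, b ∈ I`, every `x` with `x ≤ a ⊔ b` belongs to `I`. -/
def IsLatIdeal {α : Type*} [Lattice α] (I : Set α) : Prop :=
  ∀ a ∈ I, ∀ b ∈ I, ∀ x : α, x ≤ a ⊔ b → x ∈ I

/-- A filter `F` is *prime* if it is nonempty and its complement is a nonempty ideal. -/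
def IsLatPrimeFilter {α : Type*} [Lattice α] (F : Set α) : Prop :=
  IsLatFilter F ∧ F.Nonempty ∧ Fᶜ.Nonempty ∧ IsLatIdeal Fᶜ

variable {n : ℕ} {L : Fin n → Type*}

/-- For a set `p ⊆ L i`, `tilde K i p = {x ∈ K : π i x ∈ p}`. -/
def tilde (K : Set (∀ i, L i)) (i : Fin n) (p : Set (L i)) : Set (∀ i, L i) :=
  {x ∈ K | x i ∈ p}

variable [∀ i, LinearOrder (L i)]

/-- The interval `[a,b]` within `K`: `{x ∈ K : a ⊓ b ≤ x ≤ a ⊔ b}`. -/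
def interval (K : Set (∀ i, L i)) (a b : ∀ i, L i) : Set (∀ i, L i) :=
  {x ∈ K | a ⊓ b ≤ x ∧ x ≤ a ⊔ b}

/-- `(u, v)` is a *gate* between `A` and `B` (subsets of `K`): `u ∈ A`, `v ∈ B`,
`u ∈ [x,v]` for all `x ∈ A`, `v ∈ [u,y]` for all `y ∈ B`, `A ∩ [u,v] = {u}` and
`B ∩ [u,v] = {v}`. -/
def IsGate (K : Set (∀ i, L i)) (A B : Set (∀ i, L i)) (u v : ∀ i, L i) : Prop :=
  u ∈ A ∧ v ∈ B ∧ (∀ x ∈ A, u ∈ interval K x v) ∧ (∀ y ∈ B, v ∈ interval K u y) ∧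
  A ∩ interval K u v = {u} ∧ B ∩ interval K u v = {v}

variable [∀ i, TopologicalSpace (L i)]

/-- `f` `(i,ε)`-leaps at the pair `(p, q)` of clopen prime filters of `L i` with
`q̃ ⊆ p̃` if there is a gate `(u,v)` between `K ∖ p̃` and `q̃` with `|f u - f v| > ε`. -/
def LeapsAt (K : Set (∀ i, L i)) (i : Fin n) (f : (∀ i, L i) → ℝ) (ε : ℝ)
    (p q : Set (L i)) : Prop :=
  IsClopen p ∧ IsLatPrimeFilter p ∧ IsClopen q ∧ IsLatPrimeFilter q ∧
  tilde K i q ⊆ tilde K i p ∧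
  ∃ u v, IsGate K (K \ tilde K i p) (tilde K i q) u v ∧ ε < |f u - f v|

/-- `f` `(i,ε)`-jumps at `p` if it `(i,ε)`-leaps at `(p,p)`. -/
def JumpsAt (K : Set (∀ i, L i)) (i : Fin n) (f : (∀ i, L i) → ℝ) (ε : ℝ)
    (p : Set (L i)) : Prop :=
  LeapsAt K i f ε p p

/-- `f` `(i,ε)`-leaps `m` times: there are clopen prime filters
`p 0, q 0, …, p (m-1), q (m-1)` of `L i` with
`p̃ 0 ⊇ q̃ 0 ⊋ p̃ 1 ⊇ q̃ 1 ⊋ … ⊋ p̃ (m-1) ⊇ q̃ (m-1)` such that (i) `f`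
`(i,ε)`-leaps at each `(p j, q j)` and (ii) whenever `f` `(i,ε)`-jumps at a clopen
prime filter `r` of `L i` there is `j` with `r = p j = q j`. -/
def LeapsTimes (K : Set (∀ i, L i)) (i : Fin n) (f : (∀ i, L i) → ℝ) (ε : ℝ)
    (m : ℕ) : Prop :=
  ∃ p q : ℕ → Set (L i),
    (∀ j < m, LeapsAt K i f ε (p j) (q j)) ∧
    (∀ j, j + 1 < m → tilde K i (p (j + 1)) ⊂ tilde K i (q j)) ∧
    (∀ r : Set (L i), JumpsAt K i f ε r → ∃ j < m, r = p j ∧ p j = q j)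

/-- Lemma on gates between `K ∖ p̃` and `q̃` in a closed sublattice of a finite
product of compact zero-dimensional linearly ordered spaces. -/
theorem stmt12 [∀ i, OrderTopology (L i)] [∀ i, CompactSpace (L i)]
    [∀ i, TotallyDisconnectedSpace (L i)] [∀ i, Nonempty (L i)]
    (K : Set (∀ i, L i)) (hKclosed : IsClosed K)
    (hKmeet : ∀ x ∈ K, ∀ y ∈ K, x ⊓ y ∈ K) (hKjoin : ∀ x ∈ K, ∀ y ∈ K, x ⊔ y ∈ K)
    (i : Fin n) (p q : Set (L i))
    (hp : IsClopen p) (hpf : IsLatPrimeFilter p)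
    (hq : IsClopen q) (hqf : IsLatPrimeFilter q)
    (hsub : tilde K i q ⊆ tilde K i p)
    (hne₁ : (K \ tilde K i p).Nonempty) (hne₂ : (tilde K i q).Nonempty)
    (a b : ∀ i, L i) (hg : IsGate K (K \ tilde K i p) (tilde K i q) a b) :
    a i < b i ∧
    (∀ c ∈ K, a i < c i → c i < b i → c ∉ tilde K i q ∧ c ∈ tilde K i p) ∧
    K \ tilde K i p = {x ∈ K | x i ≤ a i} ∧
    tilde K i q = {x ∈ K | b i ≤ x i} := by
  obtain ⟨⟨haK, ha⟩, hb, hA, hB, -, -⟩ := hg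
  have hap : a i ∉ p := fun h => ha ⟨haK, h⟩
  have hup : ∀ F : Set (L i), IsLatFilter F → ∀ x ∈ F, ∀ y, x ≤ y → y ∈ F :=
    fun F hF x hx y hxy => hF x hx x hx y (inf_le_left.trans hxy)
  have hab : a i < b i := by
    by_contra! h
    exact hap (hup p hpf.1 _ (hsub hb).2 _ h)
  have hlow : ∀ x ∈ K, x i ∉ p ↔ x i ≤ a i := by
    refine fun x hx => ⟨fun hxp => ?_, fun h hxp => hap (hup p hpf.1 _ hxp _ h)⟩
    have h : x i ⊓ b i ≤ a i := (hA x ⟨hx, fun h => hxp h.2⟩).2.1 i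
    exact (inf_le_iff.1 h).resolve_right hab.not_ge
  have hhigh : ∀ y ∈ K, y i ∈ q ↔ b i ≤ y i := by
    refine fun y hy => ⟨fun hyq => ?_, fun h => hup q hqf.1 _ hb.2 _ h⟩
    have h : b i ≤ a i ⊔ y i := (hB y ⟨hy, hyq⟩).2.2 i
    exact (le_sup_iff.1 h).resolve_left hab.not_ge
  refine ⟨hab, fun c hc hac hcb => ⟨fun h => ?_, hc, ?_⟩, ?_, ?_⟩
  · exact hcb.not_ge ((hhigh c hc).1 h.2)
  · by_contra h
    exact hac.not_ge ((hlow c hc).1 h)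
  · ext x
    exact ⟨fun h => ⟨h.1, (hlow x h.1).1 fun hxp => h.2 ⟨h.1, hxp⟩⟩,
      fun h => ⟨h.1, fun hxp => (hlow x h.1).2 h.2 hxp.2⟩⟩
  · ext y
    exact and_congr_right fun hy => hhigh y hy
end

section
/- Let K be a closed sublattice of ∏_{i=1}^n L_i as in the product setting. Let 1 ≤ i ≤ n and let p, q be clopen prime filters of L_i with q̃ ⊆ p̃, K ∖ p̃ ≠ ∅ and q̃ ≠ ∅, and let (a,b) be a gate between K ∖ p̃ and q̃. Then for every c ∈ K and every 1 ≤ j ≤ n: if π_i(c) ≥ π_i(b) and π_j(a) < π_j(b), then π_j(c) ≥ π_j(b). -/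
variable {n : ℕ} {L : Fin n → Type*}

variable [∀ i, LinearOrder (L i)]

variable [∀ i, TopologicalSpace (L i)]

/-- For a gate `(a,b)` between `K ∖ p̃` and `q̃`: if `π i c ≥ π i b` and
`π j a < π j b` then `π j c ≥ π j b`. -/
theorem stmt13 [∀ i, OrderTopology (L i)] [∀ i, CompactSpace (L i)]
    [∀ i, TotallyDisconnectedSpace (L i)] [∀ i, Nonempty (L i)]
    (K : Set (∀ i, L i)) (hKclosed : IsClosed K)
    (hKmeet : ∀ x ∈ K, ∀ y ∈ K, x ⊓ y ∈ K) (hKjoin : ∀ x ∈ K, ∀ y ∈ K, x ⊔ y ∈ K)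
    (i : Fin n) (p q : Set (L i))
    (hp : IsClopen p) (hpf : IsLatPrimeFilter p)
    (hq : IsClopen q) (hqf : IsLatPrimeFilter q)
    (hsub : tilde K i q ⊆ tilde K i p)
    (hne₁ : (K \ tilde K i p).Nonempty) (hne₂ : (tilde K i q).Nonempty)
    (a b : ∀ i, L i) (hg : IsGate K (K \ tilde K i p) (tilde K i q) a b) :
    ∀ c ∈ K, ∀ j : Fin n, b i ≤ c i → a j < b j → b j ≤ c j := by
  intro c hc j hbc hab
  obtain ⟨-, hb, -, hgate, -, -⟩ := hg
  have hcq : c ∈ tilde K i q := ⟨hc, hqf.1 (b i) hb.2 (b i) hb.2 (c i) (inf_le_left.trans hbc)⟩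
  have hle : b j ≤ a j ⊔ c j := (hgate c hcq).2.2 j
  exact (le_sup_iff.mp hle).resolve_left hab.not_ge
end

section
/- Let K be a closed sublattice of ∏_{i=1}^n L_i as in the product setting, let a, b ∈ K, and let 1 ≤ i ≤ n. If no x ∈ [a,b] satisfies π_i(a) < π_i(x) < π_i(b), then no x ∈ K satisfies π_i(a) < π_i(x) < π_i(b). -/
variable {n : ℕ} {L : Fin n → Type*}

variable [∀ i, LinearOrder (L i)]

variable [∀ i, TopologicalSpace (L i)]

/-- If no `x ∈ [a,b]` has `π i a < π i x < π i b`, then no `x ∈ K` does. -/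
theorem stmt14 [∀ i, OrderTopology (L i)] [∀ i, CompactSpace (L i)]
    [∀ i, TotallyDisconnectedSpace (L i)] [∀ i, Nonempty (L i)]
    (K : Set (∀ i, L i)) (hKclosed : IsClosed K)
    (hKmeet : ∀ x ∈ K, ∀ y ∈ K, x ⊓ y ∈ K) (hKjoin : ∀ x ∈ K, ∀ y ∈ K, x ⊔ y ∈ K)
    (a b : ∀ i, L i) (ha : a ∈ K) (hb : b ∈ K) (i : Fin n)
    (h : ∀ x ∈ interval K a b, ¬ (a i < x i ∧ x i < b i)) :
    ∀ x ∈ K, ¬ (a i < x i ∧ x i < b i) := by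
  rintro x hx ⟨hax, hxb⟩
  have hab : a i ≤ b i := (hax.trans hxb).le
  have hy : a ⊓ b ⊔ x ⊓ (a ⊔ b) ∈ interval K a b :=
    ⟨hKjoin _ (hKmeet a ha b hb) _ (hKmeet x hx _ (hKjoin a ha b hb)),
      le_sup_left, sup_le inf_le_sup inf_le_right⟩
  refine h _ hy ?_
  have hyi : (a ⊓ b ⊔ x ⊓ (a ⊔ b)) i = x i := by
    simp [hab, hax.le, hxb.le]
  rw [hyi]
  exact ⟨hax, hxb⟩
end

section
/- Let K be a closed sublattice of ∏_{i=1}^n L_i as in the product setting and let 1 ≤ i ≤ n. Let p₁, q₁, p₂, q₂ be clopen prime filters of L_i with q̃₁ ⊆ p̃₁, p̃₂ ⊊ q̃₁ and q̃₂ ⊆ p̃₂, with K ∖ p̃₁, q̃₁, K ∖ p̃₂, q̃₂ all nonempty, and for j = 1, 2 let (a_j, b_j) be a gate between K ∖ p̃_j and q̃_j. Then π_i(a₁) < π_i(b₁) ≤ π_i(a₂). -/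
variable {n : ℕ} {L : Fin n → Type*}

variable [∀ i, LinearOrder (L i)]

variable [∀ i, TopologicalSpace (L i)]

/-- A gate `(a, b)` between `K ∖ p̃` and `q̃ ⊆ p̃` satisfies `π i a < π i b`. -/
theorem IsGate.apply_lt {m : ℕ} {M : Fin m → Type*} [∀ i, LinearOrder (M i)]
    {K : Set (∀ i, M i)} {i : Fin m} {p q : Set (M i)} {a b : ∀ i, M i}
    (hg : IsGate K (K \ tilde K i p) (tilde K i q) a b) (hp : IsLatFilter p)
    (hqp : tilde K i q ⊆ tilde K i p) : a i < b i := by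
  have hb : b i ∈ p := (hqp hg.2.1).2
  refine lt_of_not_ge fun hle => hg.1.2 ⟨hg.1.1, ?_⟩
  exact hp _ hb _ hb _ (inf_le_left.trans hle)


/-- Given two nested pairs of clopen prime filters of `L i` with
`q̃₁ ⊆ p̃₁`, `p̃₂ ⊊ q̃₁`, `q̃₂ ⊆ p̃₂`, and gates `(a₁,b₁)`, `(a₂,b₂)` between
`K ∖ p̃ⱼ` and `q̃ⱼ`, we have `π i a₁ < π i b₁ ≤ π i a₂`. -/
theorem stmt15 [∀ i, OrderTopology (L i)] [∀ i, CompactSpace (L i)]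
    [∀ i, TotallyDisconnectedSpace (L i)] [∀ i, Nonempty (L i)]
    (K : Set (∀ i, L i)) (hKclosed : IsClosed K)
    (hKmeet : ∀ x ∈ K, ∀ y ∈ K, x ⊓ y ∈ K) (hKjoin : ∀ x ∈ K, ∀ y ∈ K, x ⊔ y ∈ K)
    (i : Fin n) (p₁ q₁ p₂ q₂ : Set (L i))
    (hp₁ : IsClopen p₁) (hpf₁ : IsLatPrimeFilter p₁)
    (hq₁ : IsClopen q₁) (hqf₁ : IsLatPrimeFilter q₁)
    (hp₂ : IsClopen p₂) (hpf₂ : IsLatPrimeFilter p₂)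
    (hq₂ : IsClopen q₂) (hqf₂ : IsLatPrimeFilter q₂)
    (hsub₁ : tilde K i q₁ ⊆ tilde K i p₁)
    (hssub : tilde K i p₂ ⊂ tilde K i q₁)
    (hsub₂ : tilde K i q₂ ⊆ tilde K i p₂)
    (hne₁ : (K \ tilde K i p₁).Nonempty) (hne₁' : (tilde K i q₁).Nonempty)
    (hne₂ : (K \ tilde K i p₂).Nonempty) (hne₂' : (tilde K i q₂).Nonempty)
    (a₁ b₁ a₂ b₂ : ∀ i, L i)
    (hg₁ : IsGate K (K \ tilde K i p₁) (tilde K i q₁) a₁ b₁)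
    (hg₂ : IsGate K (K \ tilde K i p₂) (tilde K i q₂) a₂ b₂) :
    a₁ i < b₁ i ∧ b₁ i ≤ a₂ i := by
  obtain ⟨c, hc_mem, hc_not⟩ := Set.exists_of_ssubset hssub
  have h₁ : a₁ i < b₁ i := hg₁.apply_lt hpf₁.1 hsub₁
  have h₂ : a₂ i < b₂ i := hg₂.apply_lt hpf₂.1 hsub₂
  have hb : b₁ i ≤ a₁ i ⊔ c i := (hg₁.2.2.2.1 c hc_mem).2.2 i
  have ha : c i ⊓ b₂ i ≤ a₂ i := (hg₂.2.2.1 c ⟨hc_mem.1, hc_not⟩).2.1 i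
  have hbc : b₁ i ≤ c i := (le_sup_iff.mp hb).resolve_left h₁.not_ge
  have hca : c i ≤ a₂ i := (inf_le_iff.mp ha).resolve_right h₂.not_ge
  exact ⟨h₁, hbc.trans hca⟩
end

section
/- Let K be a closed sublattice of ∏_{i=1}^n L_i as in the product setting, let f : K → ℝ be continuous, let ε > 0 and let 1 ≤ i ≤ n. Let u, v ∈ K with π_j(u) = π_j(v) for every j ≠ i, π_i(u) < π_i(v) and |f(u) − f(v)| > ε, and let U, V be open subsets of L_i with π_i(u) ∈ U and π_i(v) ∈ V. Then there exist a, b ∈ [u,v] with π_i(a) ∈ U, π_i(b) ∈ V and π_i(a) < π_i(b), and clopen prime filters p, q of L_i with q̃ ⊆ p̃ such that (a,b) is a gate between K ∖ p̃ and q̃ and |f(a) − f(b)| > ε (i.e., (a,b) witnesses an (i,ε)-leap of f). -/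
variable {n : ℕ} {L : Fin n → Type*}

variable [∀ i, LinearOrder (L i)]

variable [∀ i, TopologicalSpace (L i)]

theorem IsUpperSet.isLatPrimeFilter {α : Type*} [LinearOrder α] {p : Set α} (hp : IsUpperSet p)
    (hne : p.Nonempty) (hcne : pᶜ.Nonempty) : IsLatPrimeFilter p := by
  refine ⟨fun a ha b hb x hx => ?_, hne, hcne, fun a ha b hb x hx hxp => ?_⟩
  · rcases le_total a b with h | h
    · exact hp (by simpa [h] using hx) ha
    · exact hp (by simpa [h] using hx) hb
  · rcases le_total a b with h | h
    · exact hb (hp (by simpa [h] using hx) hxp)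
    · exact ha (hp (by simpa [h] using hx) hxp)

section LinearOrder

variable {α : Type*} [LinearOrder α] [TopologicalSpace α] [OrderTopology α] [CompactSpace α]
  [TotallyDisconnectedSpace α]

theorem exists_isClopen_isUpperSet_of_lt {x y : α} (hxy : x < y) :
    ∃ p : Set α, IsClopen p ∧ IsUpperSet p ∧ x ∉ p ∧ y ∈ p := by
  obtain ⟨C, hC, hxC, hyC⟩ := exists_isClopen_of_totally_separated hxy.ne
  obtain ⟨m, ⟨hmC, hmy⟩, hmax⟩ := (hC.isClosed.inter isClosed_Iic).isCompact.exists_isGreatest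
    (⟨x, hxC, hxy.le⟩ : (C ∩ Set.Iic y).Nonempty)
  have hmy' : m < y := lt_of_le_of_ne hmy (fun h => hyC (h ▸ hmC))
  obtain ⟨w, ⟨hmw, hwy⟩, hw⟩ := exists_Ico_subset_of_mem_nhds' (hC.isOpen.mem_nhds hmC) hmy'
  have heq : Set.Ioi m = Set.Ici w := by
    ext t
    refine ⟨fun hmt => le_of_not_gt fun htw => ?_, fun h => hmw.trans_le h⟩
    exact not_le_of_gt hmt
      (hmax ⟨hw ⟨le_of_lt hmt, htw⟩, (htw.le.trans hwy)⟩)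
  exact ⟨Set.Ioi m, ⟨heq ▸ isClosed_Ici, isOpen_Ioi⟩, isUpperSet_Ioi m,
    not_lt_of_ge (hmax ⟨hxC, hxy.le⟩), hmy'⟩

theorem exists_isClopen_isUpperSet_compl_subset {x y : α} (hxy : x < y) {U : Set α}
    (hU : U ∈ nhds x) :
    ∃ p : Set α, IsClopen p ∧ IsUpperSet p ∧ x ∉ p ∧ y ∈ p ∧ ∀ t, x ≤ t → t ∉ p → t ∈ U := by
  obtain ⟨w, ⟨hxw, hwy⟩, hw⟩ := exists_Ico_subset_of_mem_nhds' hU hxy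
  obtain ⟨p, hp, hup, hxp, hwp⟩ := exists_isClopen_isUpperSet_of_lt hxw
  exact ⟨p, hp, hup, hxp, hup hwy hwp, fun t hxt htp =>
    hw ⟨hxt, lt_of_not_ge fun h => htp (hup h hwp)⟩⟩

theorem exists_isClopen_isUpperSet_subset {x y : α} (hxy : x < y) {V : Set α}
    (hV : V ∈ nhds y) :
    ∃ q : Set α, IsClopen q ∧ IsUpperSet q ∧ x ∉ q ∧ y ∈ q ∧ ∀ t, t ≤ y → t ∈ q → t ∈ V := by
  obtain ⟨w, ⟨hxw, hwy⟩, hw⟩ := exists_Ioc_subset_of_mem_nhds' hV hxy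
  obtain ⟨q, hq, huq, hwq, hyq⟩ := exists_isClopen_isUpperSet_of_lt hwy
  exact ⟨q, hq, huq, fun h => hwq (huq hxw h), hyq, fun t hty htq =>
    hw ⟨lt_of_not_ge fun h => hwq (huq h htq), hty⟩⟩

end LinearOrder

section Product

variable {ι : Type*} [Finite ι] [Nonempty ι] {X : ι → Type*} [∀ j, LinearOrder (X j)]
  [∀ j, TopologicalSpace (X j)] [∀ j, OrderClosedTopology (X j)]

theorem SupClosed.exists_isGreatest {A : Set (∀ j, X j)} (hA : SupClosed A)
    (hc : IsCompact A) (hne : A.Nonempty) : ∃ M, IsGreatest A M := by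
  have := Fintype.ofFinite ι
  have h : ∀ j, ∃ x ∈ A, ∀ y ∈ A, y j ≤ x j := fun j =>
    hc.exists_isMaxOn hne (continuous_apply j).continuousOn
  choose x hx hmax using h
  refine ⟨Finset.univ.sup' Finset.univ_nonempty x, hA.finsetSup'_mem _ fun j _ => hx j,
    fun y hy j => (hmax j y hy).trans ?_⟩
  exact Finset.le_sup' x (Finset.mem_univ j) j

theorem InfClosed.exists_isLeast {A : Set (∀ j, X j)} (hA : InfClosed A)
    (hc : IsCompact A) (hne : A.Nonempty) : ∃ m, IsLeast A m := by
  have := Fintype.ofFinite ι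
  have h : ∀ j, ∃ x ∈ A, ∀ y ∈ A, x j ≤ y j := fun j =>
    hc.exists_isMinOn hne (continuous_apply j).continuousOn
  choose x hx hmin using h
  refine ⟨Finset.univ.inf' Finset.univ_nonempty x, hA.finsetInf'_mem _ fun j _ => hx j,
    fun y hy j => le_trans ?_ (hmin j y hy)⟩
  exact Finset.inf'_le x (Finset.mem_univ j) j

end Product

/-- If `A` has a greatest element `M` and `B` a least element `m`, then `(a, b)` is a gate between
`A` and `B` as soon as `a = b ⊓ M` and `b = a ⊔ m`. -/
theorem isGate_of_isGreatest_of_isLeast {n : ℕ} {L : Fin n → Type*} [∀ i, LinearOrder (L i)]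
    {K A B : Set (∀ i, L i)} {M m a b : ∀ i, L i} (hAK : A ⊆ K) (hBK : B ⊆ K)
    (hM : IsGreatest A M) (hm : IsLeast B m) (ha : a ∈ A) (hb : b ∈ B)
    (hab : a = b ⊓ M) (hba : b = a ⊔ m) : IsGate K A B a b := by
  have hle : a ≤ b := hab.trans_le inf_le_left
  have haM : a ≤ M := hM.2 ha
  refine ⟨ha, hb, fun x hx => ⟨hAK ha, ?_, hle.trans le_sup_right⟩,
    fun y hy => ⟨hBK hb, inf_le_left.trans hle, ?_⟩, ?_, ?_⟩
  · rw [inf_comm]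
    exact (inf_le_inf_left b (hM.2 hx)).trans hab.ge
  · exact hba.trans_le (sup_le_sup_left (hm.2 hy) a)
  · refine Set.eq_singleton_iff_unique_mem.2
      ⟨⟨ha, hAK ha, inf_le_left, le_sup_left⟩, fun x hx => le_antisymm ?_ ?_⟩
    · exact (le_inf (hx.2.2.2.trans (sup_le hle le_rfl)) (hM.2 hx.1)).trans hab.ge
    · exact (le_inf le_rfl hle).trans hx.2.2.1
  · refine Set.eq_singleton_iff_unique_mem.2
      ⟨⟨hb, hBK hb, inf_le_right, le_sup_right⟩, fun x hx => le_antisymm ?_ ?_⟩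
    · exact hx.2.2.2.trans (sup_le hle le_rfl)
    · exact hba.trans_le (sup_le ((le_inf le_rfl hle).trans hx.2.2.1) (hm.2 hx.1))

/-- A function continuous on `K` varies little on the points of `K` that differ from `u ∈ K` in
the `i`-th coordinate only and by little. -/
theorem ContinuousOn.exists_nhds_update {ι : Type*} [DecidableEq ι] {X : ι → Type*}
    [∀ j, TopologicalSpace (X j)] {K : Set (∀ j, X j)} {f : (∀ j, X j) → ℝ}
    (hf : ContinuousOn f K) {u : ∀ j, X j} (hu : u ∈ K) (i : ι) {δ : ℝ} (hδ : 0 < δ) :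
    ∃ W ∈ nhds (u i), ∀ x ∈ K, (∀ j, j ≠ i → x j = u j) → x i ∈ W → |f x - f u| < δ := by
  have h := hf u hu (Metric.ball_mem_nhds (f u) hδ)
  obtain ⟨W, hW, hWK⟩ := mem_nhdsWithin_iff_exists_mem_nhds_inter.1 h
  have hcont : Filter.Tendsto (fun t => Function.update u i t) (nhds (u i)) (nhds u) := by
    have : Continuous fun t => Function.update u i t := by fun_prop
    simpa using this.tendsto (u i)
  refine ⟨_, hcont hW, fun x hx hxu hxi => ?_⟩
  have hux : Function.update u i (x i) = x := by
    ext j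
    rcases eq_or_ne j i with rfl | hj
    · simp
    · simp [hj, hxu j hj]
  have := hWK ⟨by simpa [hux] using hxi, hx⟩
  simpa [Real.dist_eq] using this

/-- If `u, v ∈ K` differ only in the `i`-th coordinate, `π i u < π i v`,
`|f u - f v| > ε`, and `U`, `V` are open neighborhoods of `π i u`, `π i v` in
`L i`, then there exist `a, b ∈ [u,v]` with `π i a ∈ U`, `π i b ∈ V`,
`π i a < π i b` witnessing an `(i,ε)`-leap of `f`. -/
theorem stmt17 [∀ i, OrderTopology (L i)] [∀ i, CompactSpace (L i)]
    [∀ i, TotallyDisconnectedSpace (L i)] [∀ i, Nonempty (L i)]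
    (K : Set (∀ i, L i)) (hKclosed : IsClosed K)
    (hKmeet : ∀ x ∈ K, ∀ y ∈ K, x ⊓ y ∈ K) (hKjoin : ∀ x ∈ K, ∀ y ∈ K, x ⊔ y ∈ K)
    (f : (∀ i, L i) → ℝ) (hf : ContinuousOn f K)
    (ε : ℝ) (hε : 0 < ε) (i : Fin n)
    (u v : ∀ i, L i) (hu : u ∈ K) (hv : v ∈ K)
    (hcoord : ∀ j : Fin n, j ≠ i → u j = v j)
    (hlt : u i < v i) (hfuv : ε < |f u - f v|)
    (U V : Set (L i)) (hU : IsOpen U) (hV : IsOpen V)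
    (huU : u i ∈ U) (hvV : v i ∈ V) :
    ∃ a ∈ interval K u v, ∃ b ∈ interval K u v,
      a i ∈ U ∧ b i ∈ V ∧ a i < b i ∧
      ∃ p q : Set (L i),
        IsClopen p ∧ IsLatPrimeFilter p ∧ IsClopen q ∧ IsLatPrimeFilter q ∧
        tilde K i q ⊆ tilde K i p ∧
        IsGate K (K \ tilde K i p) (tilde K i q) a b ∧ ε < |f a - f b| := by
  obtain ⟨δ, hδ, hδε⟩ : ∃ δ > 0, ε + 2 * δ = |f u - f v| :=
    ⟨(|f u - f v| - ε) / 2, by linarith, by ring⟩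
  obtain ⟨U', hU', hfU⟩ := hf.exists_nhds_update hu i hδ
  obtain ⟨V', hV', hfV⟩ := hf.exists_nhds_update hv i hδ
  obtain ⟨p, hp, hup, hxp, hyp, hpU⟩ := exists_isClopen_isUpperSet_compl_subset hlt
    (Filter.inter_mem (hU.mem_nhds huU) hU')
  obtain ⟨q₀, hq₀, huq₀, hxq₀, hyq₀, hqV⟩ := exists_isClopen_isUpperSet_subset hlt
    (Filter.inter_mem (hV.mem_nhds hvV) hV')
  have hq : IsClopen (p ∩ q₀) := hp.inter hq₀
  have huq : IsUpperSet (p ∩ q₀) := hup.inter huq₀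
  have : Nonempty (Fin n) := ⟨i⟩
  have hsub : tilde K i (p ∩ q₀) ⊆ tilde K i p := fun x hx => ⟨hx.1, hx.2.1⟩
  have hA : K \ tilde K i p = K ∩ {x | x i ∉ p} := by
    ext x
    simp only [tilde, Set.mem_sdiff, Set.mem_inter_iff, Set.mem_ofPred_eq]
    tauto
  have huA : u ∈ K \ tilde K i p := ⟨hu, fun h => hxp h.2⟩
  have hvB : v ∈ tilde K i (p ∩ q₀) := ⟨hv, hyp, hyq₀⟩
  obtain ⟨M, hM⟩ : ∃ M, IsGreatest (K \ tilde K i p) M := by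
    refine SupClosed.exists_isGreatest (fun x hx y hy => ?_) ?_ ⟨u, huA⟩
    · rw [hA] at hx hy ⊢
      refine ⟨hKjoin x hx.1 y hy.1, ?_⟩
      rcases le_total (x i) (y i) with h | h
      · simpa [h] using hy.2
      · simpa [h] using hx.2
    · rw [hA]
      exact (hKclosed.inter (hp.compl.isClosed.preimage (continuous_apply i))).isCompact
  obtain ⟨m, hm⟩ : ∃ m, IsLeast (tilde K i (p ∩ q₀)) m := by
    refine InfClosed.exists_isLeast (fun x hx y hy => ?_) ?_ ⟨v, hvB⟩
    · refine ⟨hKmeet x hx.1 y hy.1, ?_⟩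
      rcases le_total (x i) (y i) with h | h
      · simpa only [Pi.inf_apply, inf_eq_left.2 h] using hx.2
      · simpa only [Pi.inf_apply, inf_eq_right.2 h] using hy.2
    · exact (hKclosed.inter (hq.isClosed.preimage (continuous_apply i))).isCompact
  have huM : u ≤ M := hM.2 huA
  have hmv : m ≤ v := hm.2 hvB
  have hMp : M i ∉ p := fun h => hM.1.2 ⟨hM.1.1, h⟩
  have hmq : m i ∈ p ∩ q₀ := hm.1.2
  have hMm : M i < m i := lt_of_not_ge fun h => hMp (hup h hmq.1)
  have huv : u ≤ v := fun j => by
    rcases eq_or_ne j i with rfl | hj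
    · exact hlt.le
    · exact (hcoord j hj).le
  have hai : (v ⊓ M) i = M i := inf_eq_right.2 (hMm.le.trans (hmv i))
  have hbi : (u ⊔ m) i = m i := sup_eq_right.2 ((huM i).trans hMm.le)
  have haj : ∀ j, j ≠ i → (v ⊓ M) j = u j := fun j hj => by
    rw [Pi.inf_apply, ← hcoord j hj]
    exact inf_eq_left.2 (huM j)
  have hbj : ∀ j, j ≠ i → (u ⊔ m) j = v j := fun j hj => by
    rw [Pi.sup_apply, hcoord j hj]
    exact sup_eq_left.2 (hmv j)
  have haK : v ⊓ M ∈ K := hKmeet v hv M hM.1.1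
  have hbK : u ⊔ m ∈ K := hKjoin u hu m hm.1.1
  have haU := hpU (M i) (huM i) hMp
  have hbV := hqV (m i) (hmv i) hmq.2
  refine ⟨v ⊓ M, ⟨haK, inf_le_left.trans (le_inf huv huM), inf_le_left.trans le_sup_right⟩,
    u ⊔ m, ⟨hbK, inf_le_left.trans le_sup_left, (sup_le huv hmv).trans le_sup_right⟩,
    by rw [hai]; exact haU.1, by rw [hbi]; exact hbV.1, by rw [hai, hbi]; exact hMm,
    p, p ∩ q₀, hp, hup.isLatPrimeFilter ⟨_, hyp⟩ ⟨_, hxp⟩, hq,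
    huq.isLatPrimeFilter ⟨_, hyp, hyq₀⟩ ⟨_, fun h => hxp h.1⟩, hsub, ?_, ?_⟩
  · refine isGate_of_isGreatest_of_isLeast Set.sdiff_subset (fun x hx => hx.1) hM hm
      ⟨haK, fun h => hMp (hai ▸ h.2)⟩ ⟨hbK, by rw [hbi]; exact hmq⟩ ?_ ?_ <;> ext j <;>
      rcases eq_or_ne j i with rfl | hj
    · rw [Pi.inf_apply (u ⊔ m), hai, hbi, inf_eq_right.2 hMm.le]
    · rw [Pi.inf_apply (u ⊔ m), hbj j hj, Pi.inf_apply]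
    · rw [Pi.sup_apply (v ⊓ M), hai, hbi, sup_eq_right.2 hMm.le]
    · rw [Pi.sup_apply (v ⊓ M), haj j hj, Pi.sup_apply]
  · have h₁ := hfU _ haK haj (by rw [hai]; exact haU.2)
    have h₂ := hfV _ hbK hbj (by rw [hbi]; exact hbV.2)
    have h₃ := abs_sub_le (f u) (f (v ⊓ M)) (f v)
    have h₄ := abs_sub_le (f (v ⊓ M)) (f (u ⊔ m)) (f v)
    rw [abs_sub_comm (f u) (f (v ⊓ M))] at h₃
    linarith
end

section
/- Let K be a closed sublattice of ∏_{i=1}^n L_i as in the product setting, let f : K → ℝ be continuous, let ε > 0 and let a, b ∈ K. Suppose that f has no (i,ε)-jump witnessed inside [a,b]: there is no index i, no clopen prime filter p of L_i, and no gate (u,v) between K ∖ p̃ and p̃ such that u, v ∈ [a,b] and |f(u) − f(v)| > ε. Let M = max f([a,b]) and m = min f([a,b]). Then [m,M] ∖ f([a,b]) contains no interval of length greater than ε: there are no reals r < s with s − r > ε, m ≤ r, s ≤ M, and the open interval (r,s) disjoint from f([a,b]). -/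
variable {n : ℕ} {L : Fin n → Type*}

variable [∀ i, LinearOrder (L i)]

variable [∀ i, TopologicalSpace (L i)]

/-- A nonempty compact set in a partial order with closed order relation has a maximal element. -/
theorem exists_maximal_of_isCompact {α : Type*} [PartialOrder α] [TopologicalSpace α]
    [OrderClosedTopology α] {S : Set α} (hS : IsCompact S) (hne : S.Nonempty) :
    ∃ x, Maximal (· ∈ S) x := by
  obtain ⟨x₀, hx₀⟩ := hne
  obtain ⟨x, -, hx⟩ := zorn_le_nonempty₀ S (fun c hcS hc y hy => by
    have : Nonempty c := ⟨⟨y, hy⟩⟩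
    obtain ⟨z, hz⟩ := IsCompact.nonempty_iInter_of_directed_nonempty_isCompact_isClosed
      (fun i : c => S ∩ Set.Ici (i : α))
      (fun i j => by
        rcases hc.total i.2 j.2 with h | h
        · exact ⟨j, Set.inter_subset_inter_right _ (Set.Ici_subset_Ici.2 h), subset_rfl⟩
        · exact ⟨i, subset_rfl, Set.inter_subset_inter_right _ (Set.Ici_subset_Ici.2 h)⟩)
      (fun i => ⟨i, hcS i.2, le_rfl⟩) (fun i => hS.inter_right isClosed_Ici)
      (fun i => hS.isClosed.inter isClosed_Ici)
    simp only [Set.mem_iInter] at hz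
    exact ⟨z, (hz ⟨y, hy⟩).1, fun w hw => (hz ⟨w, hw⟩).2⟩) x₀ hx₀
  exact ⟨x, hx⟩

/-- Between a point of a compact set `A` and a larger point of a compact set `B` disjoint from it,
there are comparable points of `A` and `B` with nothing of `A ∪ B` strictly in between. -/
theorem exists_lt_of_isCompact_disjoint {α : Type*} [PartialOrder α] [TopologicalSpace α]
    [OrderClosedTopology α] {A B : Set α} (hA : IsCompact A) (hB : IsCompact B)
    (hAB : Disjoint A B) {a b : α} (ha : a ∈ A) (hb : b ∈ B) (hab : a ≤ b) :
    ∃ u ∈ A, ∃ v ∈ B, a ≤ u ∧ u < v ∧ v ≤ b ∧ ∀ z ∈ A ∪ B, ¬ (u < z ∧ z < v) := by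
  obtain ⟨v, ⟨⟨hvB, hav, hvb⟩, hv⟩⟩ :=
    exists_maximal_of_isCompact (α := αᵒᵈ) (hB.inter_right (isClosed_Icc (a := a) (b := b)))
      ⟨b, hb, hab, le_rfl⟩
  obtain ⟨u, ⟨⟨huA, hau, huv⟩, hu⟩⟩ :=
    exists_maximal_of_isCompact (hA.inter_right (isClosed_Icc (a := a) (b := v)))
      ⟨a, ha, le_rfl, hav⟩
  have hne : u ≠ v := fun h => Set.disjoint_left.1 hAB huA (h ▸ hvB)
  refine ⟨u, huA, v, hvB, hau, huv.lt_of_ne hne, hvb, ?_⟩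
  rintro z (hz | hz) ⟨huz, hzv⟩
  · exact huz.not_ge (hu ⟨hz, hau.trans huz.le, hzv.le⟩ huz.le)
  · exact hzv.not_ge (hv ⟨hz, hau.trans huz.le, hzv.le.trans hvb⟩ hzv.le)

/-- In a compact totally disconnected linear order, clopen prime filters separate points. -/
theorem exists_isClopen_isLatPrimeFilter {α : Type*} [LinearOrder α] [TopologicalSpace α]
    [OrderTopology α] [CompactSpace α] [TotallyDisconnectedSpace α] {a b : α} (hab : a < b) :
    ∃ p : Set α, IsClopen p ∧ IsLatPrimeFilter p ∧ a ∉ p ∧ b ∈ p ∧ IsUpperSet p := by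
  obtain ⟨C, hC, haC, hbC⟩ := exists_isClopen_of_totally_separated hab.ne
  obtain ⟨x, -, y, -, hax, hxy, hyb, hz⟩ := exists_lt_of_isCompact_disjoint hC.isClosed.isCompact
    hC.compl.isClosed.isCompact disjoint_compl_right haC hbC hab.le
  have hIci : Set.Ici y = Set.Ioi x := by
    ext z
    refine ⟨fun h => hxy.trans_le h, fun h => not_lt.1 fun h' => hz z ?_ ⟨h, h'⟩⟩
    rw [Set.union_compl_self]
    trivial
  refine ⟨Set.Ici y, ⟨isClosed_Ici, hIci ▸ isOpen_Ioi⟩,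
    ⟨?_, ⟨y, le_rfl⟩, ⟨x, hxy.not_ge⟩, ?_⟩, (hax.trans_lt hxy).not_ge, hyb, isUpperSet_Ici y⟩
  · exact fun c hc d hd z h => (le_inf hc hd).trans h
  · intro c hc d hd z h
    simp only [Set.mem_compl_iff, Set.mem_Ici, not_le] at hc hd ⊢
    exact h.trans_lt (sup_lt_iff.2 ⟨hc, hd⟩)

/-- A covering pair of a sublattice `K` of a product of chains is a gate between `K ∖ p̃` and `p̃`
for every upper set `p` separating the two points in some coordinate. -/
theorem isGate_of_covering {n : ℕ} {L : Fin n → Type*} [∀ i, LinearOrder (L i)]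
    {K : Set (∀ i, L i)}
    (hKmeet : ∀ x ∈ K, ∀ y ∈ K, x ⊓ y ∈ K) (hKjoin : ∀ x ∈ K, ∀ y ∈ K, x ⊔ y ∈ K)
    {u v : ∀ i, L i} (hu : u ∈ K) (hv : v ∈ K) (huv : u ≤ v)
    (hcov : ∀ z ∈ K, u ≤ z → z ≤ v → z = u ∨ z = v)
    {i : Fin n} {p : Set (L i)} (hp : IsUpperSet p) (hup : u i ∉ p) (hvp : v i ∈ p) :
    IsGate K (K \ tilde K i p) (tilde K i p) u v := by
  have hout : ∀ x ∈ K \ tilde K i p, x ⊓ v ≤ u := by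
    rintro x ⟨hxK, hx⟩
    rcases hcov _ (hKjoin u hu _ (hKmeet x hxK v hv)) le_sup_left
      (sup_le huv inf_le_right) with h | h
    · exact sup_eq_left.1 h
    · have hi : u i ⊔ (x i ⊓ v i) = v i := congrFun h i
      refine absurd ⟨hxK, ?_⟩ hx
      rcases le_total (u i) (x i ⊓ v i) with h' | h'
      · rw [sup_eq_right.2 h'] at hi
        exact hp (inf_eq_right.1 hi) hvp
      · rw [sup_eq_left.2 h'] at hi
        exact absurd (hi ▸ hvp) hup
  have hin : ∀ y ∈ tilde K i p, v ≤ u ⊔ y := by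
    rintro y ⟨hyK, hy⟩
    rcases hcov _ (hKmeet v hv _ (hKjoin u hu y hyK)) (le_inf huv le_sup_left)
      inf_le_left with h | h
    · have hi : v i ⊓ (u i ⊔ y i) = u i := congrFun h i
      refine absurd ?_ hup
      rw [← hi]
      rcases le_total (v i) (u i ⊔ y i) with h' | h'
      · rwa [inf_eq_left.2 h']
      · rw [inf_eq_right.2 h']
        exact hp le_sup_right hy
    · exact inf_eq_left.1 h
  have huA : u ∈ K \ tilde K i p := ⟨hu, fun h => hup h.2⟩
  have hvB : v ∈ tilde K i p := ⟨hv, hvp⟩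
  refine ⟨huA, hvB, fun x hx => ⟨hu, hout x hx, huv.trans le_sup_right⟩,
    fun y hy => ⟨hv, inf_le_left.trans huv, hin y hy⟩, ?_, ?_⟩
  · refine Set.eq_singleton_iff_unique_mem.2 ⟨⟨huA, hu, inf_le_left, le_sup_left⟩, ?_⟩
    rintro x ⟨hxA, -, hux, hxv⟩
    rw [inf_eq_left.2 huv] at hux
    rw [sup_eq_right.2 huv] at hxv
    exact le_antisymm (inf_eq_left.2 hxv ▸ hout x hxA) hux
  · refine Set.eq_singleton_iff_unique_mem.2 ⟨⟨hvB, hv, inf_le_right, le_sup_right⟩, ?_⟩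
    rintro y ⟨hyB, -, huy, hyv⟩
    rw [inf_eq_left.2 huv] at huy
    rw [sup_eq_right.2 huv] at hyv
    exact le_antisymm hyv (sup_eq_right.2 huy ▸ hin y hyB)

/-- If `f` has no `(i,ε)`-jump witnessed inside `[a,b]`, `M = max f([a,b])` and
`m = min f([a,b])`, then `[m,M] ∖ f([a,b])` contains no interval of length
greater than `ε`. -/
theorem stmt18 [∀ i, OrderTopology (L i)] [∀ i, CompactSpace (L i)]
    [∀ i, TotallyDisconnectedSpace (L i)] [∀ i, Nonempty (L i)]
    (K : Set (∀ i, L i)) (hKclosed : IsClosed K)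
    (hKmeet : ∀ x ∈ K, ∀ y ∈ K, x ⊓ y ∈ K) (hKjoin : ∀ x ∈ K, ∀ y ∈ K, x ⊔ y ∈ K)
    (f : (∀ i, L i) → ℝ) (hf : ContinuousOn f K)
    (ε : ℝ) (hε : 0 < ε)
    (a b : ∀ i, L i) (ha : a ∈ K) (hb : b ∈ K)
    (hnojump : ¬ ∃ (i : Fin n) (p : Set (L i)) (u v : ∀ i, L i),
      IsClopen p ∧ IsLatPrimeFilter p ∧
      IsGate K (K \ tilde K i p) (tilde K i p) u v ∧
      u ∈ interval K a b ∧ v ∈ interval K a b ∧ ε < |f u - f v|)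
    (M m : ℝ)
    (hM : IsGreatest (f '' interval K a b) M)
    (hm : IsLeast (f '' interval K a b) m) :
    ¬ ∃ r s : ℝ, r < s ∧ ε < s - r ∧ m ≤ r ∧ s ≤ M ∧
      ∀ x ∈ interval K a b, f x ∉ Set.Ioo r s := by
  rintro ⟨r, s, hrs, hε', hmr, hsM, hgap⟩
  have hIclosed : IsClosed (interval K a b) :=
    hKclosed.inter (isClosed_Icc (a := a ⊓ b) (b := a ⊔ b))
  have hfI : ContinuousOn f (interval K a b) := hf.mono fun x hx => hx.1
  have hA : IsCompact (interval K a b ∩ f ⁻¹' Set.Iic r) :=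
    (hfI.preimage_isClosed_of_isClosed hIclosed isClosed_Iic).isCompact
  have hB : IsCompact (interval K a b ∩ f ⁻¹' Set.Ici s) :=
    (hfI.preimage_isClosed_of_isClosed hIclosed isClosed_Ici).isCompact
  have hdisj : Disjoint (interval K a b ∩ f ⁻¹' Set.Iic r) (interval K a b ∩ f ⁻¹' Set.Ici s) :=
    Set.disjoint_left.2 fun x hx hx' => hrs.not_ge (le_trans hx'.2 hx.2)
  have hcover : ∀ x ∈ interval K a b, f x ≤ r ∨ s ≤ f x := fun x hx =>
    (le_or_gt (f x) r).imp_right fun h => not_lt.1 fun h' => hgap x hx ⟨h, h'⟩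
  have hjump : ∀ u ∈ interval K a b, ∀ v ∈ interval K a b, u < v →
      (∀ z ∈ interval K a b, ¬ (u < z ∧ z < v)) → |f u - f v| ≤ ε := by
    intro u hu v hv huv hz
    obtain ⟨i, hi⟩ := (Pi.lt_def.1 huv).2
    obtain ⟨p, hpc, hpp, hup, hvp, hpu⟩ := exists_isClopen_isLatPrimeFilter hi
    refine not_lt.1 fun h => hnojump ⟨i, p, u, v, hpc, hpp,
      isGate_of_covering hKmeet hKjoin hu.1 hv.1 huv.le ?_ hpu hup hvp, hu, hv, h⟩
    intro z hzK huz hzv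
    by_contra! hne
    exact hz z ⟨hzK, hu.2.1.trans huz, hzv.trans hv.2.2⟩
      ⟨huz.lt_of_ne hne.1.symm, hzv.lt_of_ne hne.2⟩
  have hc : a ⊓ b ∈ interval K a b := ⟨hKmeet a ha b hb, le_rfl, inf_le_left.trans le_sup_left⟩
  obtain ⟨x, hx, hxm⟩ := hm.1
  obtain ⟨y, hy, hyM⟩ := hM.1
  rcases hcover _ hc with h | h
  · obtain ⟨u, ⟨hu, hur⟩, v, ⟨hv, hvs⟩, -, huv, -, hz⟩ := exists_lt_of_isCompact_disjoint hA hB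
      hdisj ⟨hc, h⟩ ⟨hy, hsM.trans_eq hyM.symm⟩ hy.2.1
    have := hjump u hu v hv huv fun z hzI => hz z ((hcover z hzI).imp (⟨hzI, ·⟩) (⟨hzI, ·⟩))
    have := (abs_le.1 this).1
    simp only [Set.mem_preimage, Set.mem_Iic, Set.mem_Ici] at hur hvs
    linarith
  · obtain ⟨u, ⟨hu, hus⟩, v, ⟨hv, hvr⟩, -, huv, -, hz⟩ := exists_lt_of_isCompact_disjoint hB hA
      hdisj.symm ⟨hc, h⟩ ⟨hx, hxm.trans_le hmr⟩ hx.2.1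
    have := hjump u hu v hv huv fun z hzI =>
      hz z ((hcover z hzI).symm.imp (⟨hzI, ·⟩) (⟨hzI, ·⟩))
    have := (abs_le.1 this).2
    simp only [Set.mem_preimage, Set.mem_Iic, Set.mem_Ici] at hus hvr
    linarith
end

section
/- Let K be a closed sublattice of ∏_{i=1}^n L_i as in the product setting, let f : K → ℝ be continuous and let ε > 0. Define p(1) = 3 and p(k+1) = 8·p(k) + 6. For each 1 ≤ i ≤ n let m_i be the maximal number of times f (i,ε)-leaps, and fix clopen prime filters {(p_{i,j}, q_{i,j})}_{j=1}^{m_i} of L_i witnessing this maximal leap count (that is, satisfying conditions (i) and (ii) of the definition of (i,ε)-leaping m_i times). Let a_i, b_i ∈ L_i and set C = K ∩ ∏_{i=1}^n [a_i, b_i], where [a_i, b_i] is the order interval in L_i. Assume that for every i and every 1 ≤ j ≤ m_i, C is either contained in or disjoint from K ∖ p̃_{i,j}, and C is either contained in or disjoint from q̃_{i,j}. Then the oscillation of f on C satisfies sup_{x,y ∈ C} |f(x) − f(y)| ≤ p(n)·ε. -/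
variable {n : ℕ} {L : Fin n → Type*}

variable [∀ i, LinearOrder (L i)]

variable [∀ i, TopologicalSpace (L i)]

section LatticeCore

open Set

/-- Two distinct points of a compact totally disconnected linear order are separated by a clopen
upper set. -/
theorem exists_isClopen_isUpperSet_separating {α : Type*} [LinearOrder α] [TopologicalSpace α]
    [OrderTopology α] [CompactSpace α] [TotallyDisconnectedSpace α] {s t : α} (hst : s < t) :
    ∃ p : Set α, IsClopen p ∧ IsUpperSet p ∧ s ∉ p ∧ t ∈ p := by
  obtain ⟨V, hV, htV, hsV⟩ := exists_isClopen_of_totally_separated hst.ne'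
  obtain ⟨a, ha⟩ := ((hV.compl.isClosed.inter isClosed_Iic).isCompact :
    IsCompact (Vᶜ ∩ Iic t)).exists_isGreatest ⟨s, hsV, hst.le⟩
  have hat : a < t := lt_of_le_of_ne ha.1.2 fun h => ha.1.1 (h ▸ htV)
  obtain ⟨b, hb⟩ := ((hV.isClosed.inter isClosed_Ici).isCompact :
    IsCompact (V ∩ Ici a)).exists_isLeast ⟨t, htV, hat.le⟩
  have hab : a < b := lt_of_le_of_ne hb.1.2 fun h => ha.1.1 (h ▸ hb.1.1)
  have hgap : Ioi a = Ici b := by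
    ext x
    refine ⟨fun hx => ?_, fun hx => lt_of_lt_of_le hab hx⟩
    by_contra hxb
    have hxb : x < b := not_le.1 hxb
    by_cases hxV : x ∈ V
    · exact absurd (hb.2 ⟨hxV, (mem_Ioi.1 hx).le⟩) (not_le.2 hxb)
    · exact absurd (ha.2 ⟨hxV, hxb.le.trans (hb.2 ⟨htV, hat.le⟩)⟩) (not_le.2 hx)
  refine ⟨Ioi a, ⟨hgap ▸ isClosed_Ici, isOpen_Ioi⟩, isUpperSet_Ioi a, ?_, hat⟩
  exact not_lt.2 (ha.2 ⟨hsV, hst.le⟩)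

theorem IsCompact.exists_isClopen_isUpperSet_disjoint {α : Type*} [LinearOrder α]
    [TopologicalSpace α] [OrderTopology α] [CompactSpace α] [TotallyDisconnectedSpace α]
    {N : Set α} (hN : IsCompact N) {t : α} (ht : ∀ x ∈ N, x < t) :
    ∃ q : Set α, IsClopen q ∧ IsUpperSet q ∧ t ∈ q ∧ ∀ x ∈ N, x ∉ q := by
  rcases N.eq_empty_or_nonempty with rfl | hne
  · exact ⟨univ, isClopen_univ, isUpperSet_univ, mem_univ t, by simp⟩
  · obtain ⟨r, hr⟩ := hN.exists_isGreatest hne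
    obtain ⟨q, hq, hqu, hrq, htq⟩ := exists_isClopen_isUpperSet_separating (ht r hr.1)
    exact ⟨q, hq, hqu, htq, fun x hx hxq => hrq (hqu (hr.2 hx) hxq)⟩

theorem IsCompact.exists_isClopen_isUpperSet_superset {α : Type*} [LinearOrder α]
    [TopologicalSpace α] [OrderTopology α] [CompactSpace α] [TotallyDisconnectedSpace α]
    {N : Set α} (hN : IsCompact N) {s : α} (hs : ∀ x ∈ N, s < x) :
    ∃ p : Set α, IsClopen p ∧ IsUpperSet p ∧ s ∉ p ∧ N ⊆ p := by
  rcases N.eq_empty_or_nonempty with rfl | hne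
  · exact ⟨∅, isClopen_empty, isUpperSet_empty, notMem_empty s, empty_subset _⟩
  · obtain ⟨r, hr⟩ := hN.exists_isLeast hne
    obtain ⟨p, hp, hpu, hsp, hrp⟩ := exists_isClopen_isUpperSet_separating (hs r hr.1)
    exact ⟨p, hp, hpu, hsp, fun x hx => hpu (hr.2 hx) hrp⟩

theorem IsCompact.exists_isLeast_of_infClosed {α : Type*} [Lattice α] [TopologicalSpace α]
    [OrderClosedTopology α] {S : Set α} (hS : IsCompact S) (hne : S.Nonempty)
    (hinf : InfClosed S) : ∃ m, IsLeast S m := by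
  have : Nonempty S := hne.to_subtype
  have h : (⋂ x : S, S ∩ Iic (x : α)).Nonempty := by
    refine IsCompact.nonempty_iInter_of_directed_nonempty_isCompact_isClosed
      (fun x : S => S ∩ Iic (x : α)) ?_ (fun x => ⟨x, x.2, le_rfl⟩)
      (fun x => hS.inter_right isClosed_Iic)
      (fun x => hS.isClosed.inter isClosed_Iic)
    intro x y
    exact ⟨⟨x ⊓ y, hinf x.2 y.2⟩, fun z hz => ⟨hz.1, le_trans hz.2 inf_le_left⟩,
      fun z hz => ⟨hz.1, le_trans hz.2 inf_le_right⟩⟩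
  obtain ⟨m, hm⟩ := h
  rw [mem_iInter] at hm
  exact ⟨m, (hm ⟨_, hne.some_mem⟩).1, fun x hx => (hm ⟨x, hx⟩).2⟩

theorem IsCompact.exists_isGreatest_of_supClosed {α : Type*} [Lattice α] [TopologicalSpace α]
    [OrderClosedTopology α] {S : Set α} (hS : IsCompact S) (hne : S.Nonempty)
    (hsup : SupClosed S) : ∃ m, IsGreatest S m :=
  IsCompact.exists_isLeast_of_infClosed (α := αᵒᵈ) hS hne hsup

variable {ι : Type*} {X : ι → Type*} [∀ i, LinearOrder (X i)]

/-- An order-theoretic description of the gates between the half-spaces `{x ∈ C | x i ∉ p}` and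
`{x ∈ C | x i ∈ q}` of a sublattice `C`. -/
structure HalfspaceGate (C : Set (∀ i, X i)) (i : ι) (p q : Set (X i)) (u v : ∀ i, X i) :
    Prop where
  left_mem : u ∈ C
  right_mem : v ∈ C
  left_notMem : u i ∉ p
  right_mem_filter : v i ∈ q
  le : u ≤ v
  inf_le : ∀ x ∈ C, x i ∉ p → x ⊓ v ≤ u
  le_sup : ∀ y ∈ C, y i ∈ q → v ≤ u ⊔ y

theorem IsUpperSet.inf_notMem {α : Type*} [LinearOrder α] {p : Set α} (hp : IsUpperSet p) {x : α}
    (y : α) (hx : x ∉ p) : x ⊓ y ∉ p :=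
  fun h => hx (hp inf_le_left h)

/-- Gates relative to a convex sublattice are gates relative to the whole lattice. -/
theorem HalfspaceGate.of_inter {C E : Set (∀ i, X i)} {i : ι} {p q : Set (X i)} {u v : ∀ i, X i}
    (hinf : InfClosed C) (hsup : SupClosed C) (hE : E.OrdConnected)
    (hp : IsUpperSet p) (hq : IsUpperSet q) (h : HalfspaceGate (C ∩ E) i p q u v) :
    HalfspaceGate C i p q u v where
  left_mem := h.left_mem.1
  right_mem := h.right_mem.1
  left_notMem := h.left_notMem
  right_mem_filter := h.right_mem_filter
  le := h.le
  inf_le x hx hxp := by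
    have hle : (x ⊓ v) ⊔ u ≤ v := sup_le inf_le_right h.le
    have hmem : (x ⊓ v) ⊔ u ∈ C ∩ E :=
      ⟨hsup (hinf hx h.right_mem.1) h.left_mem.1,
        hE.out h.left_mem.2 h.right_mem.2 ⟨le_sup_right, hle⟩⟩
    have hnot : ((x ⊓ v) ⊔ u) i ∉ p := by
      rw [Pi.sup_apply, Pi.inf_apply]
      rcases le_total (x i ⊓ v i) (u i) with h' | h'
      · rw [sup_eq_right.2 h']; exact h.left_notMem
      · rw [sup_eq_left.2 h']; exact hp.inf_notMem _ hxp
    have := h.inf_le _ hmem hnot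
    rw [inf_eq_left.2 hle] at this
    exact le_sup_left.trans this
  le_sup y hy hyq := by
    have hle : u ≤ (u ⊔ y) ⊓ v := le_inf le_sup_left h.le
    have hmem : (u ⊔ y) ⊓ v ∈ C ∩ E :=
      ⟨hinf (hsup h.left_mem.1 hy) h.right_mem.1,
        hE.out h.left_mem.2 h.right_mem.2 ⟨hle, inf_le_right⟩⟩
    have hin : ((u ⊔ y) ⊓ v) i ∈ q := by
      rw [Pi.inf_apply, Pi.sup_apply]
      rcases le_total (u i ⊔ y i) (v i) with h' | h'
      · rw [inf_eq_left.2 h']; exact hq le_sup_right hyq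
      · rw [inf_eq_right.2 h']; exact h.right_mem_filter
    have := h.le_sup _ hmem hin
    rw [sup_eq_right.2 hle] at this
    exact this.trans inf_le_left

theorem HalfspaceGate.of_isGreatest_isLeast {C : Set (∀ i, X i)} {i : ι} {p q : Set (X i)}
    {u v : ∀ i, X i} (hinf : InfClosed C) (hp : IsUpperSet p)
    (hu : IsGreatest {x ∈ C | x i ∉ p} u) (hv : IsLeast {x ∈ C | x i ∈ q} v) :
    HalfspaceGate C i p q (u ⊓ v) v where
  left_mem := hinf hu.1.1 hv.1.1
  right_mem := hv.1.1
  left_notMem := hp.inf_notMem _ hu.1.2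
  right_mem_filter := hv.1.2
  le := inf_le_right
  inf_le _ hx hxp := inf_le_inf_right _ (hu.2 ⟨hx, hxp⟩)
  le_sup _ hy hyq := (hv.2 ⟨hy, hyq⟩).trans le_sup_right

variable [∀ i, TopologicalSpace (X i)]

/-- `f` is continuous on the compact sublattice `C`, has no jump exceeding `ε` inside `C`, and no
two consecutive leaps exceeding `ε` inside `C`. -/
structure IsTame (C : Set (∀ i, X i)) (f : (∀ i, X i) → ℝ) (ε : ℝ) : Prop where
  isCompact : IsCompact C
  infClosed : InfClosed C
  supClosed : SupClosed C
  continuousOn : ContinuousOn f C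
  no_jump : ∀ i (p : Set (X i)) u v, IsClopen p → IsUpperSet p →
    HalfspaceGate C i p p u v → |f u - f v| ≤ ε
  no_two_leaps : ∀ i (p q p' q' : Set (X i)) u v u' v' z,
    IsClopen p → IsUpperSet p → IsClopen q → IsUpperSet q →
    IsClopen p' → IsUpperSet p' → IsClopen q' → IsUpperSet q' → q ⊆ p → q' ⊆ p' →
    z ∈ C → z i ∈ q → z i ∉ p' →
    HalfspaceGate C i p q u v → HalfspaceGate C i p' q' u' v' →
    ε < |f u - f v| → |f u' - f v'| ≤ ε

variable {C : Set (∀ i, X i)} {f : (∀ i, X i) → ℝ} {ε : ℝ}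

theorem IsTame.inter (h : IsTame C f ε) {E : Set (∀ i, X i)} (hcl : IsClosed E)
    (hinf : InfClosed E) (hsup : SupClosed E) (hE : E.OrdConnected) : IsTame (C ∩ E) f ε where
  isCompact := h.isCompact.inter_right hcl
  infClosed := h.infClosed.inter hinf
  supClosed := h.supClosed.inter hsup
  continuousOn := h.continuousOn.mono inter_subset_left
  no_jump i p u v hp hpu hg :=
    h.no_jump i p u v hp hpu (hg.of_inter h.infClosed h.supClosed hE hpu hpu)
  no_two_leaps i p q p' q' u v u' v' z hp hpu hq hqu hp' hpu' hq' hqu' hqp hqp' hz hzq hzp hg hg' :=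
    h.no_two_leaps i p q p' q' u v u' v' z hp hpu hq hqu hp' hpu' hq' hqu' hqp hqp' hz.1 hzq hzp
      (hg.of_inter h.infClosed h.supClosed hE hpu hqu)
      (hg'.of_inter h.infClosed h.supClosed hE hpu' hqu')

variable [∀ i, OrderTopology (X i)]

theorem IsTame.exists_isLeast_inter (h : IsTame C f ε) (i : ι) {q : Set (X i)} (hq : IsClosed q)
    (hne : ∃ x ∈ C, x i ∈ q) : ∃ m, IsLeast {x ∈ C | x i ∈ q} m := by
  refine IsCompact.exists_isLeast_of_infClosed
    (h.isCompact.inter_right (hq.preimage (continuous_apply i))) hne ?_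
  intro x hx y hy
  refine ⟨h.infClosed hx.1 hy.1, ?_⟩
  rcases le_total (x i) (y i) with h' | h'
  · simpa [h'] using hx.2
  · simpa [h'] using hy.2

theorem IsTame.exists_isGreatest_inter (h : IsTame C f ε) (i : ι) {q : Set (X i)}
    (hq : IsClosed q) (hne : ∃ x ∈ C, x i ∈ q) : ∃ m, IsGreatest {x ∈ C | x i ∈ q} m := by
  refine IsCompact.exists_isGreatest_of_supClosed
    (h.isCompact.inter_right (hq.preimage (continuous_apply i))) hne ?_
  intro x hx y hy
  refine ⟨h.supClosed hx.1 hy.1, ?_⟩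
  rcases le_total (x i) (y i) with h' | h'
  · simpa [h'] using hy.2
  · simpa [h'] using hx.2

/-- A leap between two slices whose least elements have `f`-values far apart. -/
theorem IsTame.exists_leap [∀ i, CompactSpace (X i)] [∀ i, TotallyDisconnectedSpace (X i)]
    (h : IsTame C f ε) {i : ι} {B : ℝ} (hB : ∀ x ∈ C, ∀ y ∈ C, x i = y i → |f x - f y| ≤ B)
    {x y : ∀ i, X i} (hx : x ∈ C) (hxy : x i < y i) (hy : IsLeast {z ∈ C | z i ∈ Ici (y i)} y)
    (hf : B + ε < |f x - f y|) :
    ∃ p q : Set (X i), IsClopen p ∧ IsUpperSet p ∧ IsClopen q ∧ IsUpperSet q ∧ q ⊆ p ∧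
      x i ∉ p ∧ y i ∈ q ∧ ∃ u v, HalfspaceGate C i p q u v ∧ ε < |f u - f v| := by
  obtain ⟨M, hM⟩ := h.exists_isGreatest_inter i (isClosed_Iic (a := x i)) ⟨x, hx, le_rfl⟩
  have hMi : M i = x i := le_antisymm hM.1.2 (hM.2 ⟨hx, le_rfl⟩ i)
  have hyC : y ∈ C := hy.1.1
  have hlt : ε < |f (M ⊓ y) - f y| := by
    have h1 := hB x hx (M ⊓ y) (h.infClosed hM.1.1 hyC) (by simp [hMi, hxy.le])
    have h2 := abs_sub_le (f x) (f (M ⊓ y)) (f y)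
    linarith
  obtain ⟨q, hq, hqu, hyq, hNq⟩ : ∃ q : Set (X i), IsClopen q ∧ IsUpperSet q ∧ y i ∈ q ∧
      ∀ t ∈ insert (x i) ((fun z => z i) '' (C ∩ ((fun z => |f (M ⊓ z) - f z|) ⁻¹' Iic ε) ∩ Iic y)),
        t ∉ q := by
    refine IsCompact.exists_isClopen_isUpperSet_disjoint (IsCompact.insert ?_ _) ?_
    · refine IsCompact.image (IsCompact.inter_right ?_ isClosed_Iic) (continuous_apply i)
      refine IsCompact.of_isClosed_subset h.isCompact ?_ inter_subset_left
      refine ContinuousOn.preimage_isClosed_of_isClosed ?_ h.isCompact.isClosed isClosed_Iic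
      refine (ContinuousOn.sub (h.continuousOn.comp ?_ ?_) h.continuousOn).abs
      · exact (continuous_pi fun j => continuous_const.inf (continuous_apply j)).continuousOn
      · exact fun z hz => h.infClosed hM.1.1 hz
    · rintro t (rfl | ⟨z, ⟨⟨hzC, hzε⟩, hzy⟩, rfl⟩)
      · exact hxy
      · by_contra hcon
        have hle : y ≤ z := hy.2 ⟨hzC, not_lt.1 hcon⟩
        obtain rfl : z = y := le_antisymm hzy hle
        exact absurd hlt (not_lt.2 hzε)
  obtain ⟨v, hv⟩ := h.exists_isLeast_inter i hq.isClosed ⟨y, hyC, hyq⟩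
  have hvlt : ε < |f (M ⊓ v) - f v| := by
    by_contra hcon
    exact hNq _ (mem_insert_of_mem _
      ⟨v, ⟨⟨hv.1.1, not_lt.1 hcon⟩, hv.2 ⟨hyC, hyq⟩⟩, rfl⟩) hv.1.2
  obtain ⟨p, hp, hpu, hxp, hNp⟩ : ∃ p : Set (X i), IsClopen p ∧ IsUpperSet p ∧ x i ∉ p ∧
      (fun z => z i) '' (C ∩ ((fun z => |f (z ⊓ v) - f v|) ⁻¹' Iic ε) ∩ Ici M) ⊆ p := by
    refine IsCompact.exists_isClopen_isUpperSet_superset ?_ ?_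
    · refine IsCompact.image (IsCompact.inter_right ?_ isClosed_Ici) (continuous_apply i)
      refine IsCompact.of_isClosed_subset h.isCompact ?_ inter_subset_left
      refine ContinuousOn.preimage_isClosed_of_isClosed ?_ h.isCompact.isClosed isClosed_Iic
      refine (ContinuousOn.sub (h.continuousOn.comp ?_ ?_) continuousOn_const).abs
      · exact (continuous_pi fun j => (continuous_apply j).inf continuous_const).continuousOn
      · exact fun z hz => h.infClosed hz hv.1.1
    · rintro t ⟨z, ⟨⟨hzC, hzε⟩, hzM⟩, rfl⟩
      by_contra hcon
      have hle : z ≤ M := hM.2 ⟨hzC, not_lt.1 hcon⟩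
      obtain rfl : z = M := le_antisymm hle hzM
      exact absurd hvlt (not_lt.2 hzε)
  have hxpq : x i ∉ p ∪ q := fun hx' => hx'.elim hxp (hNq _ (mem_insert _ _))
  have hpqu : IsUpperSet (p ∪ q) := hpu.union hqu
  obtain ⟨u, hu⟩ := h.exists_isGreatest_inter i (hp.union hq).compl.isClosed ⟨x, hx, hxpq⟩
  refine ⟨p ∪ q, q, hp.union hq, hpqu, hq, hqu, subset_union_right, hxpq, hyq, u ⊓ v, v,
    .of_isGreatest_isLeast h.infClosed hpqu hu hv, ?_⟩
  by_contra hcon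
  have hMu : M ≤ u := hu.2 ⟨hM.1.1, by rw [hMi]; exact hxpq⟩
  exact hu.1.2 (Or.inl (hNp ⟨u, ⟨⟨hu.1.1, not_lt.1 hcon⟩, hMu⟩, rfl⟩))

/-- Slices over consecutive coordinate values have close `f`-values. -/
theorem IsTame.abs_sub_le_of_consecutive [∀ i, CompactSpace (X i)]
    [∀ i, TotallyDisconnectedSpace (X i)] (h : IsTame C f ε) {i : ι} {B : ℝ}
    (hB : ∀ x ∈ C, ∀ y ∈ C, x i = y i → |f x - f y| ≤ B)
    {x y : ∀ i, X i} (hx : x ∈ C) (hxy : x i < y i) (hy : IsLeast {z ∈ C | z i ∈ Ici (y i)} y)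
    (hgap : ∀ z ∈ C, z i < y i → z i ≤ x i) : |f x - f y| ≤ B + ε := by
  obtain ⟨M, hM⟩ := h.exists_isGreatest_inter i (isClosed_Iic (a := x i)) ⟨x, hx, le_rfl⟩
  have hMi : M i = x i := le_antisymm hM.1.2 (hM.2 ⟨hx, le_rfl⟩ i)
  obtain ⟨p, hp, hpu, hxp, hyp⟩ := exists_isClopen_isUpperSet_separating hxy
  have hg : HalfspaceGate C i p p (M ⊓ y) y := by
    refine .of_isGreatest_isLeast h.infClosed hpu ⟨⟨hM.1.1, by rwa [hMi]⟩, ?_⟩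
      ⟨⟨hy.1.1, hyp⟩, ?_⟩
    · rintro z ⟨hz, hzp⟩
      refine hM.2 ⟨hz, hgap z hz (lt_of_not_ge fun h' => hzp (hpu h' hyp))⟩
    · rintro z ⟨hz, hzp⟩
      refine hy.2 ⟨hz, ?_⟩
      by_contra hcon
      exact hxp (hpu (hgap z hz (not_le.1 hcon)) hzp)
  have h1 := hB x hx (M ⊓ y) (h.infClosed hM.1.1 hy.1.1) (by simp [hMi, hxy.le])
  have h2 := abs_sub_le (f x) (f (M ⊓ y)) (f y)
  have h3 := h.no_jump i p _ _ hp hpu hg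
  linarith

theorem IsTame.exists_isLeast_slice (h : IsTame C f ε) (i : ι) {z : ∀ i, X i} (hz : z ∈ C) :
    ∃ m, m i = z i ∧ IsLeast {w ∈ C | w i ∈ Ici (m i)} m := by
  obtain ⟨m, hm⟩ := h.exists_isLeast_inter i (isClosed_Ici (a := z i)) ⟨z, hz, le_rfl⟩
  have hmi : m i = z i := le_antisymm (hm.2 ⟨hz, le_rfl⟩ i) hm.1.2
  exact ⟨m, hmi, by rwa [hmi]⟩

/-- A discrete intermediate value property along the `i`-th coordinate. -/
theorem IsTame.exists_intermediate [∀ i, CompactSpace (X i)]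
    [∀ i, TotallyDisconnectedSpace (X i)] (h : IsTame C f ε) (hε : 0 < ε) {i : ι} {B : ℝ}
    (hB : ∀ x ∈ C, ∀ y ∈ C, x i = y i → |f x - f y| ≤ B)
    {x y : ∀ i, X i} (hx : IsLeast C x) (hy : IsLeast {z ∈ C | z i ∈ Ici (y i)} y)
    (hf : B + ε < |f x - f y|) :
    ∃ z, IsLeast {w ∈ C | w i ∈ Ici (z i)} z ∧ B + ε < |f x - f z| ∧
      |f x - f z| ≤ 2 * B + 2 * ε := by
  have hcont : ContinuousOn (fun z => |f x - f z|) C :=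
    (continuousOn_const.sub h.continuousOn).abs
  have himg : IsClosed ((fun z : ∀ i, X i => z i) '' C) :=
    (h.isCompact.image (continuous_apply i)).isClosed
  set S : Set (X i) := (fun z : ∀ i, X i => z i) ''
    {z | IsLeast {w ∈ C | w i ∈ Ici (z i)} z ∧ B + ε < |f x - f z|} with hS
  have hSC : S ⊆ (fun z : ∀ i, X i => z i) '' C := by
    rintro _ ⟨z, hz, rfl⟩
    exact ⟨z, hz.1.1.1, rfl⟩
  obtain ⟨t, ht⟩ := (isClosed_closure (s := S)).isCompact.exists_isLeast
    ⟨y i, subset_closure ⟨y, ⟨hy, hf⟩, rfl⟩⟩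
  obtain ⟨w, hwC, hwt⟩ := closure_minimal hSC himg ht.1
  obtain ⟨m, hmw, hm⟩ := h.exists_isLeast_slice i hwC
  obtain rfl : m i = t := hmw.trans hwt
  have hmC : m ∈ C := hm.1.1
  by_cases hlarge : B + ε < |f x - f m|
  · refine ⟨m, hm, hlarge, ?_⟩
    have hsmall : ∀ z, IsLeast {w ∈ C | w i ∈ Ici (z i)} z → z i < m i →
        |f x - f z| ≤ B + ε := fun z hz hlt => by
      by_contra hcon
      exact absurd (ht.2 (subset_closure ⟨z, ⟨hz, not_le.1 hcon⟩, rfl⟩)) (not_le.2 hlt)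
    have hxm : x i < m i := by
      refine lt_of_le_of_ne (hx.2 hmC i) fun heq => ?_
      have := hB x hx.1 m hmC heq
      linarith
    set A : Set (X i) := (fun z : ∀ i, X i => z i) '' {z | z ∈ C ∧ z i < m i} with hA
    have hAC : A ⊆ (fun z : ∀ i, X i => z i) '' C := image_mono fun z hz => hz.1
    obtain ⟨s, hs⟩ := (isClosed_closure (s := A)).isCompact.exists_isGreatest
      ⟨x i, subset_closure ⟨x, ⟨hx.1, hxm⟩, rfl⟩⟩
    obtain ⟨w', hwC', hws'⟩ := closure_minimal hAC himg hs.1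
    obtain ⟨m', hmw', hm'⟩ := h.exists_isLeast_slice i hwC'
    obtain rfl : m' i = s := hmw'.trans hws'
    have hle : m' i ≤ m i := by
      refine closure_minimal ?_ (isClosed_Iic (a := m i)) hs.1
      rintro _ ⟨z, hz, rfl⟩
      exact hz.2.le
    rcases hle.lt_or_eq with hlt | heq
    · have h1 := hsmall m' hm' hlt
      have h2 := h.abs_sub_le_of_consecutive hB hm'.1.1 hlt hm
        fun z hz hzm => hs.2 (subset_closure ⟨z, ⟨hz, hzm⟩, rfl⟩)
      have h3 := abs_sub_le (f x) (f m') (f m)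
      linarith
    · exfalso
      obtain ⟨q, hq, hqu, hmq, hNq⟩ := IsCompact.exists_isClopen_isUpperSet_disjoint
        (N := (fun z : ∀ i, X i => z i) ''
          (C ∩ ((fun z => |f x - f z|) ⁻¹' Iic (B + ε)) ∩ Iic m)) (t := m i)
        (by
          refine IsCompact.image (IsCompact.inter_right ?_ isClosed_Iic) (continuous_apply i)
          exact h.isCompact.of_isClosed_subset
            (hcont.preimage_isClosed_of_isClosed h.isCompact.isClosed isClosed_Iic)
            inter_subset_left)
        (by
          rintro _ ⟨z, ⟨⟨hzC, hzε⟩, hzm⟩, rfl⟩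
          by_contra hcon
          obtain rfl : z = m := le_antisymm hzm (hm.2 ⟨hzC, not_lt.1 hcon⟩)
          exact absurd hlarge (not_lt.2 hzε))
      obtain ⟨_, hzq, z, ⟨hzC, hzm⟩, rfl⟩ := mem_closure_iff.1 (heq ▸ hs.1) q hq.isOpen hmq
      obtain ⟨n, hnz, hn⟩ := h.exists_isLeast_slice i hzC
      have hnm : n i < m i := hnz.trans_lt hzm
      refine hNq (n i) ⟨n, ⟨⟨hn.1.1, hsmall n hn hnm⟩, hn.2 ⟨hmC, hnm.le⟩⟩, rfl⟩ ?_
      rw [hnz]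
      exact hzq
  · have hcont' : ContinuousOn (fun z => |f z - f m|) C :=
      (h.continuousOn.sub continuousOn_const).abs
    obtain ⟨p, hp, hpu, hmp, hNp⟩ := IsCompact.exists_isClopen_isUpperSet_superset
      (N := (fun z : ∀ i, X i => z i) ''
        (C ∩ ((fun z => |f z - f m|) ⁻¹' Ici (B + ε)) ∩ ((fun z => z i) ⁻¹' Ici (m i))))
      (s := m i)
      (by
        refine IsCompact.image (IsCompact.inter_right ?_
          (isClosed_Ici.preimage (continuous_apply i))) (continuous_apply i)
        exact h.isCompact.of_isClosed_subset
          (hcont'.preimage_isClosed_of_isClosed h.isCompact.isClosed isClosed_Ici)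
          inter_subset_left)
      (by
        rintro _ ⟨z, ⟨⟨hzC, hzε⟩, hzm⟩, rfl⟩
        refine lt_of_le_of_ne hzm fun heq => ?_
        have h1 := hB z hzC m hmC heq.symm
        have h2 : B + ε ≤ |f z - f m| := hzε
        linarith)
    obtain ⟨_, hzp, z, ⟨hz, hzlarge⟩, rfl⟩ :=
      mem_closure_iff.1 ht.1 pᶜ hp.compl.isOpen hmp
    refine ⟨z, hz, hzlarge, ?_⟩
    have hmz : m i ≤ z i := ht.2 (subset_closure ⟨z, ⟨hz, hzlarge⟩, rfl⟩)
    have h1 : |f z - f m| < B + ε := by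
      by_contra hcon
      exact hzp (hNp ⟨z, ⟨⟨hz.1.1, not_lt.1 hcon⟩, hmz⟩, rfl⟩)
    have h2 := abs_sub_le (f x) (f m) (f z)
    rw [abs_sub_comm (f m) (f z)] at h2
    linarith

/-- The oscillation between the extreme elements is controlled by the oscillation on slices. -/
theorem IsTame.abs_sub_le_of_isLeast_of_isGreatest [∀ i, CompactSpace (X i)]
    [∀ i, TotallyDisconnectedSpace (X i)] (h : IsTame C f ε) (hε : 0 < ε) (i : ι) {B : ℝ}
    (hB₀ : 0 ≤ B) (hB : ∀ x ∈ C, ∀ y ∈ C, x i = y i → |f x - f y| ≤ B)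
    {x y : ∀ i, X i} (hx : IsLeast C x) (hy : IsGreatest C y) :
    |f x - f y| ≤ 4 * B + 3 * ε := by
  by_contra! hcon
  obtain ⟨m, hmy, hm⟩ := h.exists_isLeast_slice i hy.1
  have h1 := hB m hm.1.1 y hy.1 hmy
  have h2 := abs_sub_le (f x) (f m) (f y)
  obtain ⟨z, hz, hz1, hz2⟩ := h.exists_intermediate hε hB hx hm (by linarith)
  have h3 := abs_sub_le (f x) (f z) (f m)
  have hzm : B + ε < |f z - f m| := by linarith
  have hlt1 : x i < z i := lt_of_le_of_ne (hx.2 hz.1.1 i) fun heq => by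
    have := hB x hx.1 z hz.1.1 heq
    linarith
  have hlt2 : z i < m i := lt_of_le_of_ne (hmy ▸ hy.2 hz.1.1 i) fun heq => by
    have := hB z hz.1.1 m hm.1.1 heq
    linarith
  obtain ⟨p, q, hp, hpu, hq, hqu, hqp, -, hzq, u, v, hg, hl⟩ :=
    h.exists_leap hB hx.1 hlt1 hz hz1
  obtain ⟨p', q', hp', hpu', hq', hqu', hqp', hzp, -, u', v', hg', hl'⟩ :=
    h.exists_leap hB hz.1.1 hlt2 hm hzm
  exact absurd hl' (not_lt.2 (h.no_two_leaps i p q p' q' u v u' v' z hp hpu hq hqu hp' hpu' hq'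
    hqu' hqp hqp' hz.1.1 hzq hzp hg hg' hl))

theorem IsTame.abs_sub_le_of_le [∀ i, CompactSpace (X i)]
    [∀ i, TotallyDisconnectedSpace (X i)] (h : IsTame C f ε) (hε : 0 < ε) (i : ι) {B : ℝ}
    (hB₀ : 0 ≤ B) (hB : ∀ x ∈ C, ∀ y ∈ C, x i = y i → |f x - f y| ≤ B)
    {x y : ∀ i, X i} (hx : x ∈ C) (hy : y ∈ C) (hxy : x ≤ y) :
    |f x - f y| ≤ 4 * B + 3 * ε :=
  (h.inter (E := Icc x y) isClosed_Icc
    (fun _ ha _ hb => ⟨le_inf ha.1 hb.1, inf_le_left.trans ha.2⟩)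
    (fun _ ha _ hb => ⟨ha.1.trans le_sup_left, sup_le ha.2 hb.2⟩)
    ordConnected_Icc).abs_sub_le_of_isLeast_of_isGreatest hε i hB₀
    (fun a ha b hb => hB a ha.1 b hb.1)
    ⟨⟨hx, le_rfl, hxy⟩, fun _ ha => ha.2.1⟩ ⟨⟨hy, hxy, le_rfl⟩, fun _ ha => ha.2.2⟩

theorem IsTame.slice (h : IsTame C f ε) (i : ι) (t : X i) :
    IsTame (C ∩ {x | x i = t}) f ε := by
  refine h.inter (isClosed_singleton.preimage (continuous_apply i)) ?_ ?_ ⟨?_⟩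
  · intro x hx y hy
    simp_all
  · intro x hx y hy
    simp_all
  · intro x hx y hy z hz
    exact le_antisymm ((hz.2 i).trans_eq hy) (hx.symm.trans_le (hz.1 i))

/-- The oscillation of a function on a tame sublattice all of whose elements agree outside the
coordinates in `J`. -/
theorem IsTame.abs_sub_le_mul [∀ i, CompactSpace (X i)] [∀ i, TotallyDisconnectedSpace (X i)]
    (hε : 0 < ε) (P : ℕ → ℕ) (hP1 : P 1 = 3) (hPsucc : ∀ k : ℕ, 1 ≤ k → P (k + 1) = 8 * P k + 6)
    (k : ℕ) : ∀ (C : Set (∀ i, X i)), IsTame C f ε → ∀ J : Finset ι, J.card = k →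
      (∀ x ∈ C, ∀ y ∈ C, ∀ i ∉ J, x i = y i) → ∀ x ∈ C, ∀ y ∈ C, |f x - f y| ≤ P k * ε := by
  classical
  induction k with
  | zero =>
    intro C _ J hJ hconst x hx y hy
    obtain rfl : x = y := by
      funext i
      exact hconst x hx y hy i (by simp [Finset.card_eq_zero.1 hJ])
    rw [sub_self, abs_zero]
    positivity
  | succ k ih =>
    intro C h J hJ hconst x hx y hy
    obtain ⟨i, hi⟩ : J.Nonempty := Finset.card_pos.1 (by omega)
    rcases Nat.eq_zero_or_pos k with rfl | hk
    · have hB : ∀ x ∈ C, ∀ y ∈ C, x i = y i → |f x - f y| ≤ 0 := by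
        intro x hx y hy hxy
        obtain rfl : x = y := by
          funext j
          by_cases hj : j ∈ J
          · obtain rfl : j = i := Finset.card_le_one.1 hJ.le j hj i hi
            exact hxy
          · exact hconst x hx y hy j hj
        simp
      have hle : ∀ x ∈ C, ∀ y ∈ C, x i ≤ y i → x ≤ y := by
        intro x hx y hy hxy j
        by_cases hj : j ∈ J
        · obtain rfl : j = i := Finset.card_le_one.1 hJ.le j hj i hi
          exact hxy
        · exact (hconst x hx y hy j hj).le
      rw [zero_add, hP1]
      push_cast
      rcases le_total (x i) (y i) with hxy | hxy
      · have := h.abs_sub_le_of_le hε i le_rfl hB hx hy (hle x hx y hy hxy)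
        linarith
      · have := h.abs_sub_le_of_le hε i le_rfl hB hy hx (hle y hy x hx hxy)
        rw [abs_sub_comm]
        linarith
    · have hB : ∀ x ∈ C, ∀ y ∈ C, x i = y i → |f x - f y| ≤ P k * ε := by
        intro x hx y hy hxy
        refine ih _ (h.slice i (x i)) (J.erase i) ?_ ?_ x ⟨hx, rfl⟩ y ⟨hy, hxy.symm⟩
        · rw [Finset.card_erase_of_mem hi, hJ, Nat.add_sub_cancel]
        · intro a ha b hb j hj
          by_cases hji : j = i
          · subst hji
            exact ha.2.trans hb.2.symm
          · exact hconst a ha.1 b hb.1 j fun hjJ => hj (Finset.mem_erase.2 ⟨hji, hjJ⟩)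
      have hinf := h.infClosed hx hy
      have h1 := h.abs_sub_le_of_le hε i (by positivity) hB hinf hx inf_le_left
      have h2 := h.abs_sub_le_of_le hε i (by positivity) hB hinf hy inf_le_right
      have h3 := abs_sub_le (f x) (f (x ⊓ y)) (f y)
      rw [abs_sub_comm] at h1
      rw [hPsucc k hk]
      push_cast
      linarith

end LatticeCore

section Leaps

open Set

theorem isLatPrimeFilter_of_isUpperSet {α : Type*} [LinearOrder α] {p : Set α}
    (hp : IsUpperSet p) {s t : α} (hs : s ∉ p) (ht : t ∈ p) : IsLatPrimeFilter p := by
  refine ⟨fun a ha b hb x hx => ?_, ⟨t, ht⟩, ⟨s, hs⟩, fun a ha b hb x hx hxp => ?_⟩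
  · rcases inf_le_iff.1 hx with h | h
    · exact hp h ha
    · exact hp h hb
  · rcases le_sup_iff.1 hx with h | h
    · exact ha (hp h hxp)
    · exact hb (hp h hxp)

theorem IsLatPrimeFilter.isUpperSet {α : Type*} [Lattice α] {p : Set α}
    (hp : IsLatPrimeFilter p) : IsUpperSet p :=
  fun a b hab ha => hp.1 a ha a ha b (inf_le_left.trans hab)

variable {m : ℕ} {X : Fin m → Type*}

theorem tilde_ssubset_tilde [∀ i, LinearOrder (X i)] {K : Set (∀ i, X i)} {i : Fin m}
    {p q : Set (X i)} (hp : IsUpperSet p) (hq : IsUpperSet q) {x : ∀ i, X i} (hx : x ∈ K)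
    (hxq : x i ∈ q) (hxp : x i ∉ p) : tilde K i p ⊂ tilde K i q := by
  refine ⟨fun y hy => ⟨hy.1, ?_⟩, fun h => hxp (h ⟨hx, hxq⟩).2⟩
  refine hq (le_of_not_ge fun hle => hxp (hp hle hy.2)) hxq

variable [∀ i, LinearOrder (X i)]

theorem HalfspaceGate.isGate {K : Set (∀ i, X i)} {i : Fin m} {p q : Set (X i)}
    {u v : ∀ i, X i} (h : HalfspaceGate K i p q u v) :
    IsGate K (K \ tilde K i p) (tilde K i q) u v := by
  have hu : u ∈ K \ tilde K i p := ⟨h.left_mem, fun hu => h.left_notMem hu.2⟩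
  have hv : v ∈ tilde K i q := ⟨h.right_mem, h.right_mem_filter⟩
  refine ⟨hu, hv, fun x hx => ⟨hu.1, ?_, ?_⟩, fun y hy => ⟨hv.1, ?_, ?_⟩, ?_, ?_⟩
  · exact h.inf_le x hx.1 fun hxp => hx.2 ⟨hx.1, hxp⟩
  · exact h.le.trans le_sup_right
  · exact inf_le_left.trans h.le
  · exact h.le_sup y hy.1 hy.2
  · refine subset_antisymm ?_ (singleton_subset_iff.2 ⟨hu, hu.1, inf_le_left, le_sup_left⟩)
    rintro x ⟨hx, -, hx1, hx2⟩
    rw [inf_eq_left.2 h.le] at hx1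
    rw [sup_eq_right.2 h.le] at hx2
    have := h.inf_le x hx.1 fun hxp => hx.2 ⟨hx.1, hxp⟩
    rw [inf_eq_left.2 hx2] at this
    exact le_antisymm this hx1
  · refine subset_antisymm ?_ (singleton_subset_iff.2 ⟨hv, hv.1, inf_le_right, le_sup_right⟩)
    rintro x ⟨hx, -, hx1, hx2⟩
    rw [inf_eq_left.2 h.le] at hx1
    rw [sup_eq_right.2 h.le] at hx2
    have := h.le_sup x hx.1 hx.2
    rw [sup_eq_right.2 hx1] at this
    exact le_antisymm hx2 this

variable [∀ i, TopologicalSpace (X i)]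

theorem HalfspaceGate.leapsAt {K : Set (∀ i, X i)} {i : Fin m} {p q : Set (X i)}
    {u v : ∀ i, X i} {f : (∀ i, X i) → ℝ} {ε : ℝ} (h : HalfspaceGate K i p q u v)
    (hp : IsClopen p) (hpu : IsUpperSet p) (hq : IsClopen q) (hqu : IsUpperSet q) (hqp : q ⊆ p)
    (hf : ε < |f u - f v|) : LeapsAt K i f ε p q :=
  ⟨hp, isLatPrimeFilter_of_isUpperSet hpu h.left_notMem (hqp h.right_mem_filter), hq,
    isLatPrimeFilter_of_isUpperSet hqu (fun hu => h.left_notMem (hqp hu)) h.right_mem_filter,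
    fun _ hx => ⟨hx.1, hqp hx.2⟩, u, v, h.isGate, hf⟩

/-- Replacing the entries with indices in `[l, e)` of a chain of leaps by two new leaps. -/
theorem LeapsTimes.replace {K : Set (∀ i, X i)} {i : Fin m} {f : (∀ i, X i) → ℝ} {ε : ℝ} {M : ℕ}
    {p q : ℕ → Set (X i)} (hleaps : ∀ j < M, LeapsAt K i f ε (p j) (q j))
    (hchain : ∀ j, j + 1 < M → tilde K i (p (j + 1)) ⊂ tilde K i (q j))
    (hjumps : ∀ r, JumpsAt K i f ε r → ∃ j < M, r = p j ∧ p j = q j)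
    {l e : ℕ} (hle : l ≤ e) (heM : e ≤ M) (hne : ∀ j, l ≤ j → j < e → p j ≠ q j)
    {p₁ q₁ p₂ q₂ : Set (X i)} (h₁ : LeapsAt K i f ε p₁ q₁) (h₂ : LeapsAt K i f ε p₂ q₂)
    (hl : ∀ j, j + 1 = l → tilde K i p₁ ⊂ tilde K i (q j))
    (h₁₂ : tilde K i p₂ ⊂ tilde K i q₁)
    (he : e < M → tilde K i (p e) ⊂ tilde K i q₂) : LeapsTimes K i f ε (l + 2 + (M - e)) := by
  let ins (r : ℕ → Set (X i)) (r₁ r₂ : Set (X i)) (j : ℕ) : Set (X i) :=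
    if j < l then r j else if j = l then r₁ else if j = l + 1 then r₂ else r (j - (l + 2) + e)
  have ins_lt : ∀ r r₁ r₂ j, j < l → ins r r₁ r₂ j = r j := fun r r₁ r₂ j hj => if_pos hj
  have ins_zero : ∀ r r₁ r₂, ins r r₁ r₂ l = r₁ := fun r r₁ r₂ => by simp [ins]
  have ins_one : ∀ r r₁ r₂, ins r r₁ r₂ (l + 1) = r₂ := fun r r₁ r₂ => by simp [ins]
  have ins_add : ∀ r r₁ r₂ k, ins r r₁ r₂ (l + 2 + k) = r (k + e) := fun r r₁ r₂ k => by
    have h1 : ¬ l + 2 + k < l := by omega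
    have h2 : ¬ l + 2 + k = l := by omega
    have h3 : ¬ l + 2 + k = l + 1 := by omega
    simp only [ins, if_neg h1, if_neg h2, if_neg h3, Nat.add_sub_cancel_left]
  have hcases : ∀ j, j < l ∨ j = l ∨ j = l + 1 ∨ ∃ k, j = l + 2 + k := fun j => by
    rcases lt_or_ge j (l + 2) with h | h
    · omega
    · exact .inr (.inr (.inr ⟨j - (l + 2), by omega⟩))
  refine ⟨ins p p₁ p₂, ins q q₁ q₂, fun j hj => ?_, fun j hj => ?_, fun r hr => ?_⟩
  · rcases hcases j with h | rfl | rfl | ⟨k, rfl⟩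
    · rw [ins_lt _ _ _ _ h, ins_lt _ _ _ _ h]
      exact hleaps j (by omega)
    · rwa [ins_zero, ins_zero]
    · rwa [ins_one, ins_one]
    · rw [ins_add, ins_add]
      exact hleaps _ (by omega)
  · rcases hcases j with h | rfl | rfl | ⟨k, rfl⟩
    · rw [ins_lt q _ _ _ h]
      rcases (Nat.succ_le_of_lt h).lt_or_eq with h' | h'
      · rw [ins_lt _ _ _ _ h']
        exact hchain j (by omega)
      · have h' : j + 1 = l := h'
        rw [h', ins_zero]
        exact hl j h'
    · rwa [ins_zero, ins_one]
    · rw [ins_one, show l + 1 + 1 = l + 2 + 0 from rfl, ins_add, Nat.zero_add]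
      exact he (by omega)
    · rw [ins_add, Nat.add_assoc (l + 2), ins_add, Nat.add_right_comm]
      exact hchain _ (by omega)
  · obtain ⟨j, hj, hrp, hpq⟩ := hjumps r hr
    rcases lt_or_ge j l with h | h
    · exact ⟨j, by omega, by rw [ins_lt _ _ _ _ h, ins_lt _ _ _ _ h]; exact ⟨hrp, hpq⟩⟩
    · have hej : e ≤ j := not_lt.1 fun h' => hne j h h' hpq
      refine ⟨l + 2 + (j - e), by omega, ?_⟩
      rw [ins_add, ins_add, Nat.sub_add_cancel hej]
      exact ⟨hrp, hpq⟩

/-- A convex part of `K` which is not split by a maximal chain of leaps does not contain two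
consecutive leaps. -/
theorem not_leapsAt_pair_of_maximal {K : Set (∀ i, X i)} {i : Fin m} {f : (∀ i, X i) → ℝ} {ε : ℝ}
    {M : ℕ} {p q : ℕ → Set (X i)} (hleaps : ∀ j < M, LeapsAt K i f ε (p j) (q j))
    (hchain : ∀ j, j + 1 < M → tilde K i (p (j + 1)) ⊂ tilde K i (q j))
    (hjumps : ∀ r, JumpsAt K i f ε r → ∃ j < M, r = p j ∧ p j = q j)
    (hmax : ∀ k, LeapsTimes K i f ε k → k ≤ M) {C : Set (∀ i, X i)} (hCK : C ⊆ K)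
    (hsplit : ∀ j < M, (C ⊆ K \ tilde K i (p j) ∨ Disjoint C (K \ tilde K i (p j))) ∧
      (C ⊆ tilde K i (q j) ∨ Disjoint C (tilde K i (q j))))
    {p₁ q₁ p₂ q₂ : Set (X i)} (h₁ : LeapsAt K i f ε p₁ q₁) (h₂ : LeapsAt K i f ε p₂ q₂)
    {u v z : ∀ i, X i} (hu : u ∈ C) (hv : v ∈ C) (hz : z ∈ C) (hup : u i ∉ p₁) (hzq : z i ∈ q₁)
    (hzp : z i ∉ p₂) (hvq : v i ∈ q₂) : False := by
  classical
  have hex : ∃ l, M ≤ l ∨ ¬ C ⊆ tilde K i (q l) := ⟨M, .inl le_rfl⟩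
  obtain ⟨l, hl, hlmin⟩ : ∃ l, (M ≤ l ∨ ¬ C ⊆ tilde K i (q l)) ∧
      ∀ j < l, j < M ∧ C ⊆ tilde K i (q j) :=
    ⟨Nat.find hex, Nat.find_spec hex, fun j hj => by
      have := Nat.find_min hex hj
      push Not at this
      exact this⟩
  have hlM : l ≤ M := by
    by_contra h
    exact absurd (hlmin M (by omega)).1 (lt_irrefl M)
  have hbefore : ∀ j, j + 1 = l → tilde K i p₁ ⊂ tilde K i (q j) := fun j hj => by
    obtain ⟨hjM, hCq⟩ := hlmin j (by omega)
    exact tilde_ssubset_tilde h₁.2.1.isUpperSet (hleaps j hjM).2.2.2.1.isUpperSet (hCK hu)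
      (hCq hu).2 hup
  have hbetween : tilde K i p₂ ⊂ tilde K i q₁ :=
    tilde_ssubset_tilde h₂.2.1.isUpperSet h₁.2.2.2.1.isUpperSet (hCK hz) hzq hzp
  have hafter : ∀ e < M, v i ∉ p e → tilde K i (p e) ⊂ tilde K i q₂ := fun e he hve =>
    tilde_ssubset_tilde (hleaps e he).2.1.isUpperSet h₂.2.2.2.1.isUpperSet (hCK hv) hvq hve
  rcases hlM.eq_or_lt with rfl | hlt
  · have := hmax _ (LeapsTimes.replace hleaps hchain hjumps le_rfl le_rfl (by omega) h₁ h₂ hbefore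
      hbetween fun h => absurd h (lt_irrefl _))
    omega
  have hdisj : Disjoint C (tilde K i (q l)) :=
    (hsplit l hlt).2.resolve_left (hl.resolve_left (not_le.2 hlt))
  rcases (hsplit l hlt).1 with hCp | hCp
  · have := hmax _ (LeapsTimes.replace hleaps hchain hjumps le_rfl hlM (by omega) h₁ h₂ hbefore
      hbetween fun h => hafter l h fun hvp => (hCp hv).2 ⟨hCK hv, hvp⟩)
    omega
  · have hvp : v i ∈ p l := by
      by_contra hcon
      exact disjoint_left.1 hCp hv ⟨hCK hv, fun hv' => hcon hv'.2⟩
    have hvq' : v ∉ tilde K i (q l) := disjoint_left.1 hdisj hv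
    have := hmax _ (LeapsTimes.replace (l := l) (e := l + 1) hleaps hchain hjumps (by omega) hlt
      (fun j hj1 hj2 hpq => by
        obtain rfl : j = l := by omega
        exact hvq' ⟨hCK hv, hpq ▸ hvp⟩)
      h₁ h₂ hbefore hbetween
      fun h => hafter (l + 1) h fun hvp' => hvq' ((hchain l h).1 ⟨hCK hv, hvp'⟩))
    omega

end Leaps

/-- Oscillation estimate: if `mi i` is the maximal number of times `f`
`(i,ε)`-leaps, witnessed by families `(pf i j, qf i j)` of clopen prime filters,
and `C = K ∩ ∏ᵢ [aᵢ, bᵢ]` is either contained in or disjoint from each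
`K ∖ p̃f i j` and each `q̃f i j`, then the oscillation of `f` on `C` is at most
`P n · ε`, where `P 1 = 3` and `P (k+1) = 8 · P k + 6`. -/
theorem stmt19 [∀ i, OrderTopology (L i)] [∀ i, CompactSpace (L i)]
    [∀ i, TotallyDisconnectedSpace (L i)] [∀ i, Nonempty (L i)]
    (K : Set (∀ i, L i)) (hKclosed : IsClosed K)
    (hKmeet : ∀ x ∈ K, ∀ y ∈ K, x ⊓ y ∈ K) (hKjoin : ∀ x ∈ K, ∀ y ∈ K, x ⊔ y ∈ K)
    (f : (∀ i, L i) → ℝ) (hf : ContinuousOn f K)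
    (ε : ℝ) (hε : 0 < ε)
    (P : ℕ → ℕ) (hP1 : P 1 = 3) (hPsucc : ∀ k : ℕ, 1 ≤ k → P (k + 1) = 8 * P k + 6)
    (mi : Fin n → ℕ)
    (pf qf : (i : Fin n) → ℕ → Set (L i))
    (hleaps : ∀ i : Fin n, ∀ j < mi i, LeapsAt K i f ε (pf i j) (qf i j))
    (hchain : ∀ i : Fin n, ∀ j : ℕ, j + 1 < mi i →
      tilde K i (pf i (j + 1)) ⊂ tilde K i (qf i j))
    (hjumps : ∀ i : Fin n, ∀ r : Set (L i), JumpsAt K i f ε r →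
      ∃ j < mi i, r = pf i j ∧ pf i j = qf i j)
    (hmax : ∀ i : Fin n, ∀ m : ℕ, LeapsTimes K i f ε m → m ≤ mi i)
    (a b : ∀ i, L i)
    (C : Set (∀ i, L i))
    (hC : C = {x ∈ K | ∀ i : Fin n, a i ≤ x i ∧ x i ≤ b i})
    (hsplit : ∀ i : Fin n, ∀ j < mi i,
      (C ⊆ K \ tilde K i (pf i j) ∨ Disjoint C (K \ tilde K i (pf i j))) ∧
      (C ⊆ tilde K i (qf i j) ∨ Disjoint C (tilde K i (qf i j)))) :
    ∀ x ∈ C, ∀ y ∈ C, |f x - f y| ≤ (P n : ℝ) * ε := by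
  subst hC
  set C := {x ∈ K | ∀ i : Fin n, a i ≤ x i ∧ x i ≤ b i} with hCdef
  have hCE : C = K ∩ Set.Icc a b := by
    ext x
    simp only [hCdef, Set.mem_ofPred_eq, Set.mem_inter_iff, Set.mem_Icc, Pi.le_def, forall_and]
  have hinf : InfClosed K := fun x hx y hy => hKmeet x hx y hy
  have hsup : SupClosed K := fun x hx y hy => hKjoin x hx y hy
  have hgate : ∀ {i : Fin n} {p q : Set (L i)} {u v}, IsUpperSet p → IsUpperSet q →
      HalfspaceGate C i p q u v → HalfspaceGate K i p q u v := fun hp hq h =>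
    HalfspaceGate.of_inter hinf hsup Set.ordConnected_Icc hp hq (hCE ▸ h)
  have hCK : C ⊆ K := fun x hx => hx.1
  have htame : IsTame C f ε :=
    { isCompact := hCE ▸ (hKclosed.inter isClosed_Icc).isCompact
      infClosed := hCE ▸ hinf.inter fun _ ha _ hb => ⟨le_inf ha.1 hb.1, inf_le_left.trans ha.2⟩
      supClosed := hCE ▸ hsup.inter fun _ ha _ hb => ⟨ha.1.trans le_sup_left, sup_le ha.2 hb.2⟩
      continuousOn := hf.mono hCK
      no_jump := fun i p u v hp hpu hg => by
        by_contra! hcon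
        obtain ⟨j, hj, rfl, -⟩ :=
          hjumps i p ((hgate hpu hpu hg).leapsAt hp hpu hp hpu subset_rfl hcon)
        rcases (hsplit i j hj).1 with h | h
        · exact (h hg.right_mem).2 ⟨hCK hg.right_mem, hg.right_mem_filter⟩
        · exact Set.disjoint_left.1 h hg.left_mem
            ⟨hCK hg.left_mem, fun hu => hg.left_notMem hu.2⟩
      no_two_leaps := fun i p q p' q' u v u' v' z hp hpu hq hqu hp' hpu' hq' hqu' hqp hqp' hz hzq
          hzp hg hg' hl => by
        by_contra! hcon
        exact not_leapsAt_pair_of_maximal (hleaps i) (hchain i) (hjumps i) (hmax i) hCK (hsplit i)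
          ((hgate hpu hqu hg).leapsAt hp hpu hq hqu hqp hl)
          ((hgate hpu' hqu' hg').leapsAt hp' hpu' hq' hqu' hqp' hcon)
          hg.left_mem hg'.right_mem hz hg.left_notMem hzq hzp hg'.right_mem_filter }
  exact htame.abs_sub_le_mul hε P hP1 hPsucc n C Finset.univ (Finset.card_fin n)
    fun x _ y _ i hi => absurd (Finset.mem_univ i) hi
end
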